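/- Let (x₀, x₁, x₂, x₃, x₄) ∈ ℚ⁵ be a nonzero tuple satisfying x₀² − 2x₁² + x₂² = 0, x₁² − 2x₂² + 409·x₃² = 0 and x₂² − 2·409·x₃² + x₄² = 0. Then there exist a nonzero rational number λ and signs ε₀, ε₁, ε₂, ε₃, ε₄ ∈ {1, −1} such that (x₀, x₁, x₂, x₃, x₄) = λ·(7ε₀, 13ε₁, 17ε₂, ε₃, 23ε₄). Consequently, the only non-constant arithmetic progression of five squares over ℚ(√409), up to equivalence, is 7², 13², 17², 409, 23². -/

import Mathlib

/-- The elliptic curve `y² = x³ + 2x² - 8x`. -/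
def EC : WeierstrassCurve.Affine ℚ := ⟨0, 2, 0, -8, 0⟩

/-- The point `P` is the affine point with coordinates `(x, y)`. -/
def IsPt (P : EC.Point) (x y : ℚ) : Prop := ∃ h, P = WeierstrassCurve.Affine.Point.some x y h

theorem ec_equation (x y : ℚ) : EC.Equation x y ↔ y ^ 2 = x ^ 3 + 2 * x ^ 2 - 8 * x := by
  rw [WeierstrassCurve.Affine.equation_iff]
  simp only [EC]
  constructor <;> intro h <;> linarith

theorem ec_nonsingular {x y : ℚ} (h : y ^ 2 = x ^ 3 + 2 * x ^ 2 - 8 * x) :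
    EC.Nonsingular x y := by
  rw [WeierstrassCurve.Affine.nonsingular_iff]
  refine ⟨(ec_equation x y).2 h, ?_⟩
  simp only [EC]
  by_contra hc
  push Not at hc
  obtain ⟨h1, h2⟩ := hc
  have hy : y = 0 := by linarith
  subst hy
  have h3 : x * (x - 2) * (x + 4) = 0 := by linarith
  rcases mul_eq_zero.1 h3 with h4 | h4
  · rcases mul_eq_zero.1 h4 with h5 | h5
    · subst h5; norm_num at h1
    · have : x = 2 := by linarith
      subst this; norm_num at h1
  · have : x = -4 := by linarith
    subst this; norm_num at h1

theorem IsPt.eqn {P : EC.Point} {x y : ℚ} (h : IsPt P x y) :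
    y ^ 2 = x ^ 3 + 2 * x ^ 2 - 8 * x := by
  obtain ⟨h, -⟩ := h
  exact (ec_equation x y).1 h.1

theorem exists_isPt {x y : ℚ} (h : y ^ 2 = x ^ 3 + 2 * x ^ 2 - 8 * x) : ∃ P, IsPt P x y :=
  ⟨_, ec_nonsingular h, rfl⟩

theorem IsPt.neg {P : EC.Point} {x y : ℚ} (h : IsPt P x y) : IsPt (-P) x (-y) := by
  obtain ⟨h, rfl⟩ := h
  have e : EC.negY x y = -y := by simp [WeierstrassCurve.Affine.negY, EC]
  rw [WeierstrassCurve.Affine.Point.neg_some]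
  exact e ▸ ⟨_, rfl⟩

theorem IsPt.unique {P : EC.Point} {x y x' y' : ℚ} (h : IsPt P x y) (h' : IsPt P x' y') :
    x = x' ∧ y = y' := by
  obtain ⟨h, rfl⟩ := h
  obtain ⟨h', e⟩ := h'
  simpa using e

theorem IsPt.ext {P Q : EC.Point} {x y : ℚ} (h : IsPt P x y) (h' : IsPt Q x y) : P = Q := by
  obtain ⟨h, rfl⟩ := h
  obtain ⟨h', rfl⟩ := h'
  rfl

theorem IsPt.eq_or_neg {P Q : EC.Point} {x y y' : ℚ} (h : IsPt P x y) (h' : IsPt Q x y') :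
    P = Q ∨ P = -Q := by
  obtain ⟨h, rfl⟩ := h
  obtain ⟨h', rfl⟩ := h'
  exact WeierstrassCurve.Affine.Point.X_eq_iff.1 rfl

theorem IsPt.congr {P : EC.Point} {x y x' y' : ℚ} (h : IsPt P x y) (hx : x = x') (hy : y = y') :
    IsPt P x' y' := by subst hx hy; exact h

theorem IsPt.add {P Q : EC.Point} {x₁ y₁ x₂ y₂ L : ℚ} (hP : IsPt P x₁ y₁) (hQ : IsPt Q x₂ y₂)
    (hx : x₁ ≠ x₂) (hL : L * (x₁ - x₂) = y₁ - y₂) :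
    IsPt (P + Q) (L ^ 2 - 2 - x₁ - x₂) (-(L * ((L ^ 2 - 2 - x₁ - x₂) - x₁) + y₁)) := by
  obtain ⟨h, rfl⟩ := hP
  obtain ⟨h', rfl⟩ := hQ
  have hs : EC.slope x₁ x₂ y₁ y₂ = L := by
    rw [WeierstrassCurve.Affine.slope_of_X_ne hx, ← hL]
    field_simp [sub_ne_zero.2 hx]
  rw [WeierstrassCurve.Affine.Point.add_of_X_ne hx]
  refine IsPt.congr ⟨_, rfl⟩ ?_ ?_
  · rw [hs]; simp only [WeierstrassCurve.Affine.addX, EC]; ring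
  · rw [hs]
    simp only [WeierstrassCurve.Affine.addY, WeierstrassCurve.Affine.negY,
      WeierstrassCurve.Affine.negAddY, WeierstrassCurve.Affine.addX, EC]
    ring

theorem IsPt.dbl {P : EC.Point} {x y L : ℚ} (hP : IsPt P x y)
    (hy : y ≠ 0) (hL : L * (2 * y) = 3 * x ^ 2 + 4 * x - 8) :
    IsPt (P + P) (L ^ 2 - 2 - 2 * x) (-(L * ((L ^ 2 - 2 - 2 * x) - x) + y)) := by
  obtain ⟨h, rfl⟩ := hP
  have hn : EC.negY x y = -y := by simp [WeierstrassCurve.Affine.negY, EC]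
  have hy' : y ≠ EC.negY x y := by
    rw [hn]; intro h; apply hy; linarith
  have hs : EC.slope x x y y = L := by
    rw [WeierstrassCurve.Affine.slope_of_Y_ne rfl hy', hn]
    rw [div_eq_iff (by intro h; apply hy; linarith)]
    simp only [EC]
    linarith
  rw [WeierstrassCurve.Affine.Point.add_self_of_Y_ne hy']
  refine IsPt.congr ⟨_, rfl⟩ ?_ ?_
  · rw [hs]; simp only [WeierstrassCurve.Affine.addX, EC]; ring
  · rw [hs]
    simp only [WeierstrassCurve.Affine.addY, WeierstrassCurve.Affine.negY,
      WeierstrassCurve.Affine.negAddY, WeierstrassCurve.Affine.addX, EC]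
    ring

/-- The rational number `q` is `p`-integral and reduces to `z` modulo `p`. -/
def Rd (p : ℕ) (q : ℚ) (z : ZMod p) : Prop :=
  ∃ a b : ℤ, (b : ZMod p) ≠ 0 ∧ q * b = a ∧ (a : ZMod p) = z * b

theorem Rd.int (p : ℕ) [Fact p.Prime] (n : ℤ) : Rd p n n := ⟨n, 1, by simp, by simp, by simp⟩

theorem Rd.add {p : ℕ} [Fact p.Prime] {q r : ℚ} {z w : ZMod p} (h : Rd p q z) (h' : Rd p r w) :
    Rd p (q + r) (z + w) := by
  obtain ⟨a, b, h1, h2, h3⟩ := h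
  obtain ⟨c, d, h4, h5, h6⟩ := h'
  refine ⟨a * d + c * b, b * d, ?_, ?_, ?_⟩
  · push_cast; exact mul_ne_zero h1 h4
  · push_cast; rw [← h2, ← h5]; ring
  · push_cast; rw [h3, h6]; ring

theorem Rd.mul {p : ℕ} [Fact p.Prime] {q r : ℚ} {z w : ZMod p} (h : Rd p q z) (h' : Rd p r w) :
    Rd p (q * r) (z * w) := by
  obtain ⟨a, b, h1, h2, h3⟩ := h
  obtain ⟨c, d, h4, h5, h6⟩ := h'
  refine ⟨a * c, b * d, ?_, ?_, ?_⟩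
  · push_cast; exact mul_ne_zero h1 h4
  · push_cast; rw [← h2, ← h5]; ring
  · push_cast; rw [h3, h6]; ring

theorem Rd.neg {p : ℕ} [Fact p.Prime] {q : ℚ} {z : ZMod p} (h : Rd p q z) : Rd p (-q) (-z) := by
  obtain ⟨a, b, h1, h2, h3⟩ := h
  refine ⟨-a, b, h1, ?_, ?_⟩
  · push_cast; rw [← h2]; ring
  · push_cast; rw [h3]; ring

theorem Rd.sub {p : ℕ} [Fact p.Prime] {q r : ℚ} {z w : ZMod p} (h : Rd p q z) (h' : Rd p r w) :
    Rd p (q - r) (z - w) := by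
  rw [sub_eq_add_neg, sub_eq_add_neg]; exact h.add h'.neg

theorem Rd.pow {p : ℕ} [Fact p.Prime] {q : ℚ} {z : ZMod p} (h : Rd p q z) (n : ℕ) :
    Rd p (q ^ n) (z ^ n) := by
  induction n with
  | zero => simpa using Rd.int p 1
  | succ n ih => rw [pow_succ, pow_succ]; exact ih.mul h

theorem Rd.inv {p : ℕ} [Fact p.Prime] {q : ℚ} {z : ZMod p} (h : Rd p q z) (hz : z ≠ 0) :
    Rd p q⁻¹ z⁻¹ := by
  obtain ⟨a, b, h1, h2, h3⟩ := h
  have ha : (a : ZMod p) ≠ 0 := by rw [h3]; exact mul_ne_zero hz h1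
  have hq : q ≠ 0 := by
    rintro rfl
    rw [zero_mul] at h2
    have : a = 0 := by exact_mod_cast h2.symm
    apply ha; rw [this]; simp
  refine ⟨b, a, ha, ?_, ?_⟩
  · rw [← h2]; field_simp
  · rw [h3]; field_simp

theorem Rd.div {p : ℕ} [Fact p.Prime] {q r : ℚ} {z w : ZMod p} (h : Rd p q z) (h' : Rd p r w)
    (hw : w ≠ 0) : Rd p (q / r) (z / w) := by
  rw [div_eq_mul_inv, div_eq_mul_inv]; exact h.mul (h'.inv hw)

theorem Rd.unique {p : ℕ} [Fact p.Prime] {q : ℚ} {z w : ZMod p} (h : Rd p q z) (h' : Rd p q w) :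
    z = w := by
  obtain ⟨a, b, h1, h2, h3⟩ := h
  obtain ⟨c, d, h4, h5, h6⟩ := h'
  have e : a * d = c * b := by
    have : (a * d : ℚ) = c * b := by rw [← h2, ← h5]; ring
    exact_mod_cast this
  have e' : (a * d : ZMod p) = c * b := by exact_mod_cast congrArg (Int.cast : ℤ → ZMod p) e
  rw [h3, h6] at e'
  have : (z - w) * (b * d) = 0 := by linear_combination e'
  rcases mul_eq_zero.1 this with h | h
  · exact sub_eq_zero.1 h
  · exact absurd h (mul_ne_zero h1 h4)

theorem Rd.sqrt {p : ℕ} [Fact p.Prime] {q : ℚ} {z : ZMod p} (h : Rd p (q ^ 2) z) :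
    ∃ s : ZMod p, z = s ^ 2 := by
  obtain ⟨a, b, h1, h2, h3⟩ := h
  have hd : (q.den : ℚ) ≠ 0 := by exact_mod_cast q.den_nz
  have e : q.num ^ 2 * b = a * (q.den : ℤ) ^ 2 := by
    have h4 : q * q.den = q.num := Rat.mul_den_eq_num q
    have : ((q.num ^ 2 * b : ℤ) : ℚ) = (a * (q.den : ℤ) ^ 2 : ℤ) := by
      push_cast
      rw [← h4, ← h2]; ring
    exact_mod_cast this
  have e' : (q.num : ZMod p) ^ 2 * b = a * (q.den : ZMod p) ^ 2 := by
    exact_mod_cast congrArg (Int.cast : ℤ → ZMod p) e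
  have hden : (q.den : ZMod p) ≠ 0 := by
    intro h0
    rw [h0] at e'
    have h5 : (q.num : ZMod p) = 0 := by
      simpa [h1] using e'
    have h6 : p ∣ q.den := (ZMod.natCast_eq_zero_iff _ _).1 h0
    have h7 : (p : ℤ) ∣ q.num := (ZMod.intCast_zmod_eq_zero_iff_dvd _ _).1 h5
    have h8 : p ∣ q.num.natAbs := Int.natCast_dvd.1 h7
    have := Nat.dvd_gcd h8 h6
    rw [q.reduced.gcd_eq_one] at this
    exact (Fact.out : p.Prime).one_lt.ne' (Nat.dvd_one.1 this)
  refine ⟨q.num / q.den, ?_⟩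
  rw [div_pow, eq_div_iff (pow_ne_zero _ hden)]
  rw [h3] at e'
  apply mul_right_cancel₀ h1
  linear_combination -e'

theorem Rd.congr {p : ℕ} {q r : ℚ} {z w : ZMod p} (h : Rd p q z) (h1 : q = r) (h2 : z = w) :
    Rd p r w := by subst h1 h2; exact h

theorem reduction_step {p : ℕ} [Fact p.Prime] {P Z : EC.Point} {x y z w : ℚ} {X Y : ZMod p}
    (hP : IsPt P x y) (hZ : IsPt Z z w) (hX : Rd p x X) (hY : Rd p y Y)
    (hz : z ≠ 0) (hw : w ≠ 0) (ht : Rd p (z / w) 0) (he : Rd p (w / z ^ 2) 0) :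
    ∃ x' y', IsPt (P + Z) x' y' ∧ Rd p x' X ∧ Rd p y' Y := by
  obtain ⟨t, htd⟩ : ∃ t, t = z / w := ⟨_, rfl⟩
  obtain ⟨e, hed⟩ : ∃ e, e = w / z ^ 2 := ⟨_, rfl⟩
  rw [← htd] at ht
  rw [← hed] at he
  have ht0 : t ≠ 0 := by rw [htd]; exact div_ne_zero hz hw
  have he0 : e ≠ 0 := by rw [hed]; exact div_ne_zero hw (pow_ne_zero _ hz)
  have hze : z = 1 / (t * e) := by rw [htd, hed]; field_simp
  have hwe : w = 1 / (t ^ 2 * e) := by rw [htd, hed]; field_simp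
  have hq := hZ.eqn
  have hκ : e = t * (1 + 2 * t * e - 8 * t ^ 2 * e ^ 2) := by
    rw [hze, hwe] at hq
    field_simp at hq
    linear_combination hq
  have hD : Rd p (1 - x * t * e) 1 :=
    ((Rd.int p 1).sub ((hX.mul ht).mul he)).congr (by simp) (by simp)
  have hD0 : 1 - x * t * e ≠ 0 := by
    intro h0
    rw [h0] at hD
    have := hD.unique (Rd.int p 0 |>.congr (by simp) rfl)
    simp at this
  obtain ⟨D, hDd⟩ : ∃ D, D = 1 - x * t * e := ⟨_, rfl⟩
  have hxz : x ≠ z := by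
    rw [hze]; intro h
    apply hD0
    rw [h]; field_simp; ring
  have hxze : x - z = -D / (t * e) := by rw [hze, hDd]; field_simp; ring
  have key := hP.add hZ hxz (L := (1 - y * t ^ 2 * e) / (t * D)) (by
    rw [hxze, hwe]
    rw [← hDd] at hD0
    field_simp; ring)
  rw [← hDd] at hD hD0
  have i2 : Rd p 2 2 := (Rd.int p 2).congr (by norm_num) (by norm_num)
  have i8 : Rd p 8 8 := (Rd.int p 8).congr (by norm_num) (by norm_num)
  have i1 : Rd p 1 1 := (Rd.int p 1).congr (by norm_num) (by norm_num)
  have e1 : (1 - y * t ^ 2 * e) ^ 2 / (t * D) ^ 2 - 1 / (t * e) = (2 - 8 * t * e - 2 * y * e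
      + y ^ 2 * t ^ 2 * e ^ 2 + 2 * x - x ^ 2 * t * e) / D ^ 2 := by
    field_simp
    rw [hDd]
    linear_combination hκ
  have ex : ((1 - y * t ^ 2 * e) / (t * D)) ^ 2 - 2 - x - z = (2 - 8 * t * e - 2 * y * e
      + y ^ 2 * t ^ 2 * e ^ 2 + 2 * x - x ^ 2 * t * e) / D ^ 2 - 2 - x := by
    rw [← e1, div_pow, hze]; ring
  have e2 : (2 - 8 * t * e - 2 * y * e
      + y ^ 2 * t ^ 2 * e ^ 2 + 2 * x - x ^ 2 * t * e) / D ^ 2 - 2 - x - x = t * ((-8 * e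
      - 2 * y * (1 + 2 * t * e - 8 * t ^ 2 * e ^ 2) + y ^ 2 * t * e ^ 2 - x ^ 2 * e
      + (2 + 2 * x) * (2 * x * e - x ^ 2 * t * e ^ 2)) / D ^ 2) := by
    field_simp
    rw [hDd]
    linear_combination (-2 * y) * hκ
  rw [ex, e2] at key
  refine ⟨_, _, key.congr (x' := (2 - 8 * t * e - 2 * y * e + y ^ 2 * t ^ 2 * e ^ 2 + 2 * x
      - x ^ 2 * t * e) / D ^ 2 - 2 - x) (y' := -((1 - y * t ^ 2 * e) * ((-8 * e
      - 2 * y * (1 + 2 * t * e - 8 * t ^ 2 * e ^ 2) + y ^ 2 * t * e ^ 2 - x ^ 2 * e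
      + (2 + 2 * x) * (2 * x * e - x ^ 2 * t * e ^ 2)) / D ^ 3) + y)) rfl ?_, ?_, ?_⟩
  · field_simp
  · have hn : Rd p (2 - 8 * t * e - 2 * y * e + y ^ 2 * t ^ 2 * e ^ 2 + 2 * x
      - x ^ 2 * t * e) (2 - 8 * 0 * 0 - 2 * Y * 0 + Y ^ 2 * 0 ^ 2 * 0 ^ 2 + 2 * X
      - X ^ 2 * 0 * 0) := by
      repeat' first | exact hX | exact hY | exact ht | exact he | exact i1 | exact i2 | exact i8 | apply Rd.add | apply Rd.sub | apply Rd.mul | apply Rd.pow | apply Rd.neg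
    refine (((hn.div (hD.pow 2) (by simp)).sub i2).sub hX).congr rfl ?_
    simp; ring
  · have hn : Rd p (-8 * e - 2 * y * (1 + 2 * t * e - 8 * t ^ 2 * e ^ 2) + y ^ 2 * t * e ^ 2
      - x ^ 2 * e + (2 + 2 * x) * (2 * x * e - x ^ 2 * t * e ^ 2)) (-8 * 0
      - 2 * Y * (1 + 2 * 0 * 0 - 8 * 0 ^ 2 * 0 ^ 2) + Y ^ 2 * 0 * 0 ^ 2
      - X ^ 2 * 0 + (2 + 2 * X) * (2 * X * 0 - X ^ 2 * 0 * 0 ^ 2)) := by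
      repeat' first | exact hX | exact hY | exact ht | exact he | exact i1 | exact i2 | exact i8 | apply Rd.add | apply Rd.sub | apply Rd.mul | apply Rd.pow | apply Rd.neg
    have hn' : Rd p (1 - y * t ^ 2 * e) (1 - Y * 0 ^ 2 * 0) := by
      repeat' first | exact hX | exact hY | exact ht | exact he | exact i1 | exact i2 | exact i8 | apply Rd.add | apply Rd.sub | apply Rd.mul | apply Rd.pow | apply Rd.neg
    refine ((hn'.mul (hn.div (hD.pow 3) (by simp))).add hY).neg.congr rfl ?_
    simp; ring

theorem reduction_nat {p : ℕ} [Fact p.Prime] {P Z : EC.Point} {x y z w : ℚ} {X Y : ZMod p}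
    (hP : IsPt P x y) (hZ : IsPt Z z w) (hX : Rd p x X) (hY : Rd p y Y)
    (hz : z ≠ 0) (hw : w ≠ 0) (ht : Rd p (z / w) 0) (he : Rd p (w / z ^ 2) 0) (n : ℕ) :
    ∃ x' y', IsPt (P + n • Z) x' y' ∧ Rd p x' X ∧ Rd p y' Y := by
  induction n with
  | zero => exact ⟨x, y, by simpa using hP, hX, hY⟩
  | succ n ih =>
    obtain ⟨x', y', h1, h2, h3⟩ := ih
    rw [succ_nsmul, ← add_assoc]
    exact reduction_step h1 hZ h2 h3 hz hw ht he

theorem reduction_int {p : ℕ} [Fact p.Prime] {P Z : EC.Point} {x y z w : ℚ} {X Y : ZMod p}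
    (hP : IsPt P x y) (hZ : IsPt Z z w) (hX : Rd p x X) (hY : Rd p y Y)
    (hz : z ≠ 0) (hw : w ≠ 0) (ht : Rd p (z / w) 0) (he : Rd p (w / z ^ 2) 0) (n : ℤ) :
    ∃ x' y', IsPt (P + n • Z) x' y' ∧ Rd p x' X ∧ Rd p y' Y := by
  obtain ⟨k, rfl | rfl⟩ := n.eq_nat_or_neg
  · rw [natCast_zsmul]; exact reduction_nat hP hZ hX hY hz hw ht he k
  · rw [neg_zsmul, natCast_zsmul, ← neg_nsmul]
    refine reduction_nat hP hZ.neg hX hY hz (neg_ne_zero.2 hw) ?_ ?_ k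
    · exact ht.neg.congr (by rw [div_neg]) neg_zero
    · exact he.neg.congr (by rw [neg_div]) neg_zero

theorem IsPt.dbl' {P : EC.Point} {u y : ℚ} (hP : IsPt P u y) (hy : y ≠ 0) :
    IsPt (P + P) (((u ^ 2 + 8) / (2 * y)) ^ 2)
      ((u ^ 2 + 8) * (u ^ 2 - 4 * u - 8) * (u ^ 2 + 8 * u - 8) / (8 * y ^ 3)) := by
  have h := hP.eqn
  have ex : ((3 * u ^ 2 + 4 * u - 8) / (2 * y)) ^ 2 - 2 - 2 * u =
      ((u ^ 2 + 8) / (2 * y)) ^ 2 := by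
    field_simp
    linear_combination (-(8 + 8 * u)) * h
  have key := hP.dbl hy (L := (3 * u ^ 2 + 4 * u - 8) / (2 * y)) (by field_simp)
  rw [ex] at key
  refine key.congr rfl ?_
  field_simp
  linear_combination 8 * (4 * u * (3 * u ^ 2 + 4 * u - 8)
    - 8 * (y ^ 2 + u ^ 3 + 2 * u ^ 2 - 8 * u)) * h

/-- The point `(4, 8)`. -/
noncomputable def S0 : EC.Point :=
  WeierstrassCurve.Affine.Point.some 4 8 (ec_nonsingular (by norm_num))

/-- The two-torsion point `(0, 0)`. -/
noncomputable def T0 : EC.Point :=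
  WeierstrassCurve.Affine.Point.some 0 0 (ec_nonsingular (by norm_num))

theorem isPt_S0 : IsPt S0 4 8 := ⟨_, rfl⟩

theorem isPt_T0 : IsPt T0 0 0 := ⟨_, rfl⟩

theorem two_T0 : T0 + T0 = 0 := by
  apply WeierstrassCurve.Affine.Point.add_self_of_Y_eq
  simp [WeierstrassCurve.Affine.negY, EC]

theorem odd_zsmul_T0 {m : ℤ} (hm : Odd m) : m • T0 = T0 := by
  obtain ⟨k, rfl⟩ := hm
  rw [add_zsmul, one_zsmul, mul_comm, mul_zsmul, two_zsmul, two_T0, zsmul_zero, zero_add]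

theorem IsPt.add_T0 {P : EC.Point} {u y : ℚ} (hP : IsPt P u y) (hu : u ≠ 0) :
    IsPt (P + T0) (-8 / u) (8 * y / u ^ 2) := by
  have h := hP.eqn
  have ex : (y / u) ^ 2 - 2 - u - 0 = -8 / u := by
    field_simp
    linear_combination h
  have key := hP.add isPt_T0 hu (L := y / u) (by field_simp; ring)
  rw [ex] at key
  refine key.congr rfl ?_
  field_simp
  ring

theorem isPt_2S0 : IsPt (2 • S0) (9 / 4) (-15 / 8) := by
  rw [two_nsmul]
  exact (isPt_S0.dbl' (by norm_num)).congr (by norm_num) (by norm_num)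

theorem isPt_3S0 : IsPt (3 • S0) (1156 / 49) (-40664 / 343) := by
  rw [show 3 = 2 + 1 from rfl, add_nsmul, one_nsmul]
  exact (isPt_2S0.add isPt_S0 (by norm_num) (L := 79 / 14) (by norm_num)).congr
    (by norm_num) (by norm_num)

/-- A point that is `(a²/b², acd/b³)` with suitable integers `a, b, c, d`. -/
structure St (P : EC.Point) (a b c d : ℤ) : Prop where
  pt : IsPt P ((a : ℚ) ^ 2 / (b : ℚ) ^ 2) ((a : ℚ) * c * d / (b : ℚ) ^ 3)
  hc : c ^ 2 = a ^ 2 - 2 * b ^ 2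
  hd : d ^ 2 = a ^ 2 + 4 * b ^ 2
  cop : IsCoprime a b
  b0 : b ≠ 0
  b2 : 2 ∣ b
  a0 : 0 < a
  a4 : a % 4 = 1

theorem St.c0 {P : EC.Point} {a b c d : ℤ} (h : St P a b c d) : c ≠ 0 := by
  rintro rfl
  have h1 := h.hc
  obtain ⟨k, rfl⟩ := h.b2
  have h4 := h.a4
  have : a ^ 2 = 2 * (4 * k ^ 2) := by linear_combination -h1
  have h5 : 2 ∣ a ^ 2 := ⟨_, this⟩
  have := Int.prime_two.dvd_of_dvd_pow h5
  omega

theorem St.d0 {P : EC.Point} {a b c d : ℤ} (h : St P a b c d) : d ≠ 0 := by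
  rintro rfl
  have h1 := h.hd
  have := h.a0
  nlinarith [sq_nonneg b, mul_pos this this]

theorem three_dvd_of {a b : ℤ} (h : (3 : ℤ) ∣ a ^ 2 + b ^ 2) : 3 ∣ a ∧ 3 ∣ b := by
  have key : ∀ x y : ZMod 3, x ^ 2 + y ^ 2 = 0 → x = 0 ∧ y = 0 := by decide
  have h1 : ((a ^ 2 + b ^ 2 : ℤ) : ZMod 3) = 0 := (ZMod.intCast_zmod_eq_zero_iff_dvd _ 3).2 h
  push_cast at h1
  obtain ⟨h2, h3⟩ := key _ _ h1
  exact ⟨(ZMod.intCast_zmod_eq_zero_iff_dvd _ 3).1 h2, (ZMod.intCast_zmod_eq_zero_iff_dvd _ 3).1 h3⟩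

theorem St.cop' {P : EC.Point} {a b c d : ℤ} (h : St P a b c d) :
    IsCoprime (a ^ 4 + 8 * b ^ 4) (2 * a * b * c * d) := by
  have ha := h.a0
  apply isCoprime_of_prime_dvd
  · rintro ⟨h1, -⟩
    have : 0 < a ^ 4 + 8 * b ^ 4 := by positivity
    omega
  intro q hq h1 h2
  have hab : q ∣ a → ¬ q ∣ b := fun ha hb => hq.not_isUnit (h.cop.isUnit_of_dvd' ha hb)
  have hb : ¬ q ∣ b := by
    intro hb
    refine hab (hq.dvd_of_dvd_pow (n := 4) ?_) hb
    have : q ∣ 8 * b ^ 4 := (dvd_pow hb (by norm_num)).mul_left _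
    simpa using dvd_sub h1 this
  have hq2 : ¬ q ∣ 2 := by
    intro h3
    have h4 : q ∣ a ^ 4 := by
      have : q ∣ 8 * b ^ 4 := (h3.trans ⟨4, by norm_num⟩).mul_right _
      simpa using dvd_sub h1 this
    have h5 := hq.dvd_of_dvd_pow h4
    have h6 : a = 2 * (2 * (a / 4)) + 1 := by have := h.a4; omega
    have h7 : q ∣ 2 * (2 * (a / 4)) := h3.mul_right _
    rw [h6] at h5
    exact hq.not_isUnit (isUnit_of_dvd_one (by simpa using dvd_sub h5 h7))
  have hq3 : q ∣ 3 → ∀ x y : ℤ, q ∣ x ^ 2 + y ^ 2 → q ∣ x ∧ q ∣ y := by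
    intro h3 x y hxy
    have has := hq.associated_of_dvd Int.prime_three h3
    obtain ⟨h4, h5⟩ := three_dvd_of (has.symm.dvd.trans hxy)
    exact ⟨h3.trans h4, h3.trans h5⟩
  rcases hq.dvd_or_dvd h2 with h2 | h2
  · rcases hq.dvd_or_dvd h2 with h2 | h2
    · rcases hq.dvd_or_dvd h2 with h2 | h2
      · rcases hq.dvd_or_dvd h2 with h2 | h2
        · exact hq2 h2
        · have : q ∣ a ^ 4 := dvd_pow h2 (by norm_num)
          have : q ∣ 8 * b ^ 4 := by simpa using dvd_sub h1 this
          rcases hq.dvd_or_dvd this with h3 | h3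
          · exact hq2 (hq.dvd_of_dvd_pow (n := 3) (by norm_num; exact h3))
          · exact hb (hq.dvd_of_dvd_pow h3)
      · exact hb h2
    · have h3 : q ∣ a ^ 2 - 2 * b ^ 2 := by rw [← h.hc]; exact dvd_pow h2 (by norm_num)
      have h4 : q ∣ 2 * (2 * (3 * b ^ 4)) := by
        have := dvd_sub h1 (h3.mul_right (a ^ 2 + 2 * b ^ 2))
        ring_nf at this ⊢
        exact this
      rcases hq.dvd_or_dvd h4 with h4 | h4
      · exact hq2 h4
      rcases hq.dvd_or_dvd h4 with h4 | h4
      · exact hq2 h4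
      rcases hq.dvd_or_dvd h4 with h4 | h4
      · have := dvd_add h3 (h4.mul_right (b ^ 2))
        exact hb (hq3 h4 a b (by ring_nf at this ⊢; exact this)).2
      · exact hb (hq.dvd_of_dvd_pow h4)
  · have h3 : q ∣ a ^ 2 + 4 * b ^ 2 := by rw [← h.hd]; exact dvd_pow h2 (by norm_num)
    have h4 : q ∣ 2 * (2 * (2 * (3 * b ^ 4))) := by
      have := dvd_sub h1 (h3.mul_right (a ^ 2 - 4 * b ^ 2))
      ring_nf at this ⊢
      exact this
    rcases hq.dvd_or_dvd h4 with h4 | h4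
    · exact hq2 h4
    rcases hq.dvd_or_dvd h4 with h4 | h4
    · exact hq2 h4
    rcases hq.dvd_or_dvd h4 with h4 | h4
    · exact hq2 h4
    rcases hq.dvd_or_dvd h4 with h4 | h4
    · have := dvd_sub h3 (h4.mul_right (b ^ 2))
      exact hb (hq3 h4 a b (by ring_nf at this ⊢; exact this)).2
    · exact hb (hq.dvd_of_dvd_pow h4)

theorem St.dbl {P : EC.Point} {a b c d : ℤ} (h : St P a b c d) :
    St (P + P) (a ^ 4 + 8 * b ^ 4) (2 * a * b * c * d) (a ^ 4 - 4 * a ^ 2 * b ^ 2 - 8 * b ^ 4)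
      (a ^ 4 + 8 * a ^ 2 * b ^ 2 - 8 * b ^ 4) := by
  have hc0 := h.c0
  have hd0 := h.d0
  have ha := h.a0.ne'
  have hb := h.b0
  have hcq : (c : ℚ) ≠ 0 := by exact_mod_cast hc0
  have hdq : (d : ℚ) ≠ 0 := by exact_mod_cast hd0
  have haq : (a : ℚ) ≠ 0 := by exact_mod_cast ha
  have hbq : (b : ℚ) ≠ 0 := by exact_mod_cast hb
  refine ⟨?_, ?_, ?_, ?_, ?_, ?_, ?_, ?_⟩
  · refine (h.pt.dbl' (by positivity)).congr ?_ ?_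
    · push_cast; field_simp
    · push_cast; field_simp; ring
  · have : (2 * a * b * c * d) ^ 2 = 4 * a ^ 2 * b ^ 2 * c ^ 2 * d ^ 2 := by ring
    rw [this, h.hc, h.hd]; ring
  · have : (2 * a * b * c * d) ^ 2 = 4 * a ^ 2 * b ^ 2 * c ^ 2 * d ^ 2 := by ring
    rw [this, h.hc, h.hd]; ring
  · exact h.cop'
  · positivity
  · exact ⟨a * b * c * d, by ring⟩
  · have := h.a0
    positivity
  · obtain ⟨k, rfl⟩ := h.b2
    obtain ⟨l, hl⟩ : ∃ l, a = 4 * l + 1 := ⟨a / 4, by have := h.a4; omega⟩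
    have : a ^ 4 + 8 * (2 * k) ^ 4 = 4 * (64 * l ^ 4 + 64 * l ^ 3 + 24 * l ^ 2 + 4 * l
      + 32 * k ^ 4) + 1 := by rw [hl]; ring
    omega

theorem natCast_ne_zero_of_prime {p q : ℕ} (hp : p.Prime) (hq : q.Prime) (h : p ≠ q) :
    ((q : ℕ) : ZMod p) ≠ 0 := by
  intro h0
  exact h ((Nat.prime_dvd_prime_iff_eq hp hq).1 ((ZMod.natCast_eq_zero_iff _ _).1 h0))

theorem aux17 : ∀ X s : ZMod 17, 49 * X = 1156 → 3 * 2 + X = 818 * 2 * s ^ 2 → False := by decide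

theorem sieve {W R : EC.Point} {a b c d : ℤ} (h : St W a b c d)
    (hJ : jacobiSym (-11861) a.natAbs = -1) {m : ℤ} (hm : Odd m) (hR : R = 3 • S0 + m • W)
    {v w y : ℚ} (hv : IsPt R (4 * v ^ 2) y) (hv0 : v ≠ 0) (hw : 3 * v ^ 2 - 1 = 818 * w ^ 2) :
    False := by
  obtain ⟨p, hp, hpa, hJp⟩ := jacobiSym.eq_neg_one_at_prime_divisor_of_eq_neg_one hJ
  have : Fact p.Prime := ⟨hp⟩
  have hns := ZMod.nonsquare_iff_jacobiSym_eq_neg_one.1 hJp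
  have hp2 : p ≠ 2 := by
    rintro rfl; norm_num at hJp
  have hp5 : p ≠ 5 := by
    rintro rfl; norm_num at hJp
  have hp7 : p ≠ 7 := by
    rintro rfl; norm_num at hJp
  have hp409 : p ≠ 409 := by
    rintro rfl; norm_num at hJp
  have z2 : (2 : ZMod p) ≠ 0 := by simpa using natCast_ne_zero_of_prime hp Nat.prime_two hp2
  have z5 : (5 : ZMod p) ≠ 0 := by
    simpa using natCast_ne_zero_of_prime hp (by norm_num : Nat.Prime 5) hp5
  have z7 : (7 : ZMod p) ≠ 0 := by
    simpa using natCast_ne_zero_of_prime hp (by norm_num : Nat.Prime 7) hp7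
  have z409 : (409 : ZMod p) ≠ 0 := by
    simpa using natCast_ne_zero_of_prime hp (by norm_num : Nat.Prime 409) hp409
  have z8 : (8 : ZMod p) ≠ 0 := by
    have := pow_ne_zero 3 z2; norm_num at this; exact this
  have z4 : (4 : ZMod p) ≠ 0 := by
    have := pow_ne_zero 2 z2; norm_num at this; exact this
  have z818 : (818 : ZMod p) ≠ 0 := by
    have := mul_ne_zero z2 z409; norm_num at this; exact this
  have hpa' : (p : ℤ) ∣ a := Int.natCast_dvd.2 hpa
  have za : (a : ZMod p) = 0 := (ZMod.intCast_zmod_eq_zero_iff_dvd _ _).2 hpa'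
  have zb : (b : ZMod p) ≠ 0 := by
    intro hb
    have hb' : (p : ℤ) ∣ b := (ZMod.intCast_zmod_eq_zero_iff_dvd _ _).1 hb
    have := h.cop.isUnit_of_dvd' hpa' hb'
    exact (Nat.prime_iff_prime_int.1 hp).not_isUnit this
  have zc : (c : ZMod p) ≠ 0 := by
    intro hc
    have h1 := congrArg (Int.cast : ℤ → ZMod p) h.hc
    push_cast at h1
    rw [hc, za] at h1
    have h2 : (2 : ZMod p) * b ^ 2 = 0 := by linear_combination h1
    exact mul_ne_zero z2 (pow_ne_zero 2 zb) h2
  have zd : (d : ZMod p) ≠ 0 := by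
    intro hc
    have h1 := congrArg (Int.cast : ℤ → ZMod p) h.hd
    push_cast at h1
    rw [hc, za] at h1
    have h2 : (4 : ZMod p) * b ^ 2 = 0 := by linear_combination -h1
    exact mul_ne_zero z4 (pow_ne_zero 2 zb) h2
  have hcq : (c : ℚ) ≠ 0 := by exact_mod_cast h.c0
  have hdq : (d : ℚ) ≠ 0 := by exact_mod_cast h.d0
  have haq : (a : ℚ) ≠ 0 := by exact_mod_cast h.a0.ne'
  have hbq : (b : ℚ) ≠ 0 := by exact_mod_cast h.b0
  have hZ := (h.pt.add_T0 (by positivity)).congr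
    (x' := -8 * b ^ 2 / a ^ 2) (y' := 8 * b * c * d / a ^ 3) (by field_simp) (by field_simp)
  have ra : Rd p a 0 := (Rd.int p a).congr rfl za
  have rb := Rd.int p b
  have rc := Rd.int p c
  have rd := Rd.int p d
  have r8 : Rd p 8 8 := (Rd.int p 8).congr (by norm_num) (by norm_num)
  have r3 : Rd p 3 3 := (Rd.int p 3).congr (by norm_num) (by norm_num)
  have r1 : Rd p 1 1 := (Rd.int p 1).congr (by norm_num) (by norm_num)
  have r2 : Rd p 2 2 := (Rd.int p 2).congr (by norm_num) (by norm_num)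
  have r7 : Rd p 7 7 := (Rd.int p 7).congr (by norm_num) (by norm_num)
  have r818 : Rd p 818 818 := (Rd.int p 818).congr (by norm_num) (by norm_num)
  have rX : Rd p (1156 / 49) (1156 / 7 ^ 2) :=
    (((Rd.int p 1156).div (r7.pow 2) (pow_ne_zero 2 z7))).congr (by norm_num) (by norm_num)
  have rY : Rd p (-40664 / 343) (-40664 / 7 ^ 3) :=
    (((Rd.int p (-40664)).div (r7.pow 3) (pow_ne_zero 3 z7))).congr (by norm_num) (by norm_num)
  obtain ⟨x', y', hx', hrx, -⟩ := reduction_int isPt_3S0 hZ rX rY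
    (by simp [haq, hbq]) (by simp [haq, hbq, hcq, hdq])
    (((ra.mul rb).neg.div (rc.mul rd) (mul_ne_zero zc zd)).congr (by field_simp) (by simp))
    ((((ra.mul rc).mul rd).div (r8.mul (rb.pow 3)) (mul_ne_zero z8 (pow_ne_zero 3 zb))).congr
      (by field_simp) (by simp)) m
  have e1 : 3 • S0 + m • (W + T0) = R + T0 := by
    rw [zsmul_add, odd_zsmul_T0 hm, hR, add_assoc]
  rw [e1] at hx'
  have e2 := (hx'.unique (hv.add_T0 (by positivity))).1
  obtain ⟨X, hXd⟩ : ∃ X : ZMod p, X = 1156 / 7 ^ 2 := ⟨_, rfl⟩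
  have hX : 49 * X = 1156 := by
    rw [hXd]; field_simp; norm_num
  rw [← hXd] at hrx
  by_cases hp17 : p = 17
  · subst hp17
    have e3 : (w / v) ^ 2 = (3 + x' / 2) / 818 := by
      rw [e2]; field_simp; linear_combination -8 * hw
    have r4 : Rd 17 ((w / v) ^ 2) ((3 + X / 2) / 818) :=
      (((r3.add (hrx.div r2 z2)).div r818 z818)).congr e3.symm rfl
    obtain ⟨s, hs⟩ := r4.sqrt
    field_simp at hs
    exact aux17 X s hX (by linear_combination hs)
  · have z17 : (17 : ZMod p) ≠ 0 := by
      simpa using natCast_ne_zero_of_prime hp (by norm_num : Nat.Prime 17) hp17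
    have hX0 : X ≠ 0 := by
      rintro rfl
      have := mul_ne_zero z4 (pow_ne_zero 2 z17)
      apply this
      linear_combination -hX
    have e3 : w ^ 2 = (3 * (-2 / x') - 1) / 818 := by
      have : -2 / x' = v ^ 2 := by rw [e2]; field_simp; norm_num
      rw [this, hw]; field_simp
    have r4 : Rd p (w ^ 2) ((3 * (-2 / X) - 1) / 818) :=
      (((r3.mul (r2.neg.div hrx hX0)).sub r1).div r818 z818).congr e3.symm rfl
    obtain ⟨s, hs⟩ := r4.sqrt
    rw [div_eq_iff z818] at hs
    field_simp at hs
    apply hns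
    refine ⟨34 * 409 * s / 5, ?_⟩
    field_simp
    push_cast
    apply mul_left_cancel₀ z2
    linear_combination 409 * 49 * hs + 409 * (1 + 818 * s ^ 2) * hX

theorem isPt_6S0 : IsPt (2 • (3 • S0)) (28710930249 / 5064030244)
    (-5111307385647345 / 360366520223528) := by
  rw [two_nsmul]
  exact (isPt_3S0.dbl' (by norm_num)).congr (by norm_num) (by norm_num)

theorem st_1_2 : St (2 ^ 2 • S0) 209 (-60) (-191) 241 := by
  refine ⟨?_, by norm_num, by norm_num, ⟨89, 310, by norm_num⟩, by norm_num, by norm_num,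
    by norm_num, by norm_num⟩
  rw [pow_two, mul_nsmul, two_nsmul (2 • S0)]
  exact (isPt_2S0.dbl' (by norm_num)).congr (by norm_num) (by norm_num)

theorem st_3_2 : St (2 ^ 2 • (3 • S0)) 1029472734260116798289 (-727461712354872729780)
    37590220808527802689 1782306450180253211761 := by
  refine ⟨?_, by norm_num, by norm_num, ?_, by norm_num, by norm_num,
    by norm_num, by norm_num⟩
  · rw [pow_two, mul_nsmul, two_nsmul (2 • (3 • S0))]
    exact (isPt_6S0.dbl' (by norm_num)).congr (by norm_num) (by norm_num)
  · rw [Int.isCoprime_iff_gcd_eq_one]; norm_num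

theorem St.next {P : EC.Point} {k : ℕ} {a b c d : ℤ} (h : St (2 ^ k • P) a b c d) :
    St (2 ^ (k + 1) • P) (a ^ 4 + 8 * b ^ 4) (2 * a * b * c * d)
      (a ^ 4 - 4 * a ^ 2 * b ^ 2 - 8 * b ^ 4) (a ^ 4 + 8 * a ^ 2 * b ^ 2 - 8 * b ^ 4) := by
  rw [pow_succ, mul_nsmul', two_nsmul, nsmul_add]
  exact h.dbl

theorem St.jac {P : EC.Point} {a b c d : ℤ} (h : St P a b c d) :
    jacobiSym (-11861) a.natAbs = jacobiSym a 29 * jacobiSym a 409 := by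
  obtain ⟨n, rfl⟩ := Int.eq_ofNat_of_zero_le h.a0.le
  have h4 := h.a4
  have hn4 : n % 4 = 1 := by omega
  have hodd : Odd n := by rw [Nat.odd_iff]; omega
  rw [Int.natAbs_natCast, show (-11861 : ℤ) = -1 * ((29 : ℕ) * (409 : ℕ)) by norm_num,
    jacobiSym.mul_left, jacobiSym.mul_left, jacobiSym.at_neg_one hodd,
    ZMod.χ₄_nat_one_mod_four hn4, one_mul,
    jacobiSym.quadratic_reciprocity_one_mod_four (by norm_num) hodd,
    jacobiSym.quadratic_reciprocity_one_mod_four (by norm_num) hodd]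

/-- The values of `u` modulo `409` along the doubling sequence. -/
def tab : Fin 10 → ℤ := ![102, 6, 77, 328, 180, 403, 12, 245, 407, 309]

theorem tab_step : ∀ r : Fin 10,
    (409 : ℤ) ∣ tab (r + 1) * (4 * tab r * (tab r - 2) * (tab r + 4)) - (tab r ^ 2 + 8) ^ 2 ∧
    ¬ (409 : ℤ) ∣ 4 * tab r * (tab r - 2) * (tab r + 4) := by decide

theorem tab_choice (r : Fin 10) : jacobiSym (tab (r + 2) ^ 2 + 8) 409 = -1 ∨
    jacobiSym (tab (r + 9) ^ 2 + 8) 409 = -1 := by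
  fin_cases r <;> simp [tab] <;> norm_num

theorem prime409 : Prime (409 : ℤ) := by norm_num

open scoped Fin.CommRing Fin.NatCast in
theorem tower {P : EC.Point} {s : Fin 10} {k : ℕ}
    (h : ∃ a b c d, St (2 ^ k • P) a b c d ∧ 29 ∣ b ∧ 409 ∣ a ^ 2 - tab s * b ^ 2 ∧ ¬ 409 ∣ b)
    (i : ℕ) :
    ∃ a b c d, St (2 ^ (k + i) • P) a b c d ∧ 29 ∣ b ∧ 409 ∣ a ^ 2 - tab (i + s) * b ^ 2 ∧
      ¬ 409 ∣ b := by
  induction i with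
  | zero => simpa using h
  | succ i ih =>
    obtain ⟨a, b, c, d, h1, h2, h3, h4⟩ := ih
    refine ⟨_, _, _, _, h1.next, ?_, ?_, ?_⟩
    · obtain ⟨e, rfl⟩ := h2
      exact ⟨2 * a * e * c * d, by ring⟩
    · obtain ⟨⟨t, ht⟩, -⟩ := tab_step (i + s)
      obtain ⟨q, hq⟩ := h3
      have hc := h1.hc
      have hd := h1.hd
      have e1 : ((i + 1 : ℕ) : Fin 10) + s = (i : Fin 10) + s + 1 := by push_cast; ring
      rw [e1]
      generalize tab ((i : Fin 10) + s + 1) = V at *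
      generalize tab ((i : Fin 10) + s) = U at *
      have e2 : (2 * a * b * c * d) ^ 2 = 4 * a ^ 2 * b ^ 2 * c ^ 2 * d ^ 2 := by ring
      have e3 : a ^ 2 = U * b ^ 2 + 409 * q := by linear_combination hq
      have e4 : a ^ 4 = (U * b ^ 2 + 409 * q) ^ 2 := by rw [← e3]; ring
      rw [e2, hc, hd, e4, e3]
      rw [← Int.modEq_zero_iff_dvd]
      have e5 : U * b ^ 2 + 409 * q ≡ U * b ^ 2 [ZMOD 409] := by
        simp [Int.ModEq]
      have e6 : V * (4 * U * (U - 2) * (U + 4)) ≡ (U ^ 2 + 8) ^ 2 [ZMOD 409] := by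
        rw [Int.modEq_comm, Int.modEq_iff_dvd]; exact ⟨t, ht⟩
      calc ((U * b ^ 2 + 409 * q) ^ 2 + 8 * b ^ 4) ^ 2 - V * (4 * (U * b ^ 2 + 409 * q) * b ^ 2
            * (U * b ^ 2 + 409 * q - 2 * b ^ 2) * (U * b ^ 2 + 409 * q + 4 * b ^ 2))
          ≡ ((U * b ^ 2) ^ 2 + 8 * b ^ 4) ^ 2 - V * (4 * (U * b ^ 2) * b ^ 2
            * (U * b ^ 2 - 2 * b ^ 2) * (U * b ^ 2 + 4 * b ^ 2)) [ZMOD 409] := by gcongr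
        _ = (U ^ 2 + 8) ^ 2 * b ^ 8 - V * (4 * U * (U - 2) * (U + 4)) * b ^ 8 := by ring
        _ ≡ (U ^ 2 + 8) ^ 2 * b ^ 8 - (U ^ 2 + 8) ^ 2 * b ^ 8 [ZMOD 409] := by gcongr
        _ = 0 := by ring
    · obtain ⟨-, ht⟩ := tab_step (i + s)
      intro h5
      generalize tab ((i : Fin 10) + s) = U at *
      have h6 : (409 : ℤ) ∣ (2 * a * b * c * d) ^ 2 := dvd_pow h5 (by norm_num)
      have e2 : (2 * a * b * c * d) ^ 2 = 4 * a ^ 2 * b ^ 2 * c ^ 2 * d ^ 2 := by ring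
      rw [e2, h1.hc, h1.hd] at h6
      obtain ⟨q, hq⟩ := h3
      have e3 : a ^ 2 = U * b ^ 2 + 409 * q := by linear_combination hq
      rw [e3] at h6
      have e5 : U * b ^ 2 + 409 * q ≡ U * b ^ 2 [ZMOD 409] := by
        simp [Int.ModEq]
      have e6 : (4 * (U * b ^ 2 + 409 * q) * b ^ 2
            * (U * b ^ 2 + 409 * q - 2 * b ^ 2) * (U * b ^ 2 + 409 * q + 4 * b ^ 2))
          ≡ (4 * (U * b ^ 2) * b ^ 2
            * (U * b ^ 2 - 2 * b ^ 2) * (U * b ^ 2 + 4 * b ^ 2)) [ZMOD 409] := by gcongr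
      have e7 := e6.dvd_iff.1 h6
      have e8 : (409 : ℤ) ∣ 4 * U * (U - 2) * (U + 4) * b ^ 8 := by
        convert e7 using 1; ring
      rcases prime409.dvd_or_dvd e8 with h | h
      · exact ht h
      · exact h4 (prime409.dvd_of_dvd_pow h)

theorem tower_jac {P : EC.Point} {a b c d : ℤ} {U : ℤ} {k : ℕ} (h : St (2 ^ k • P) a b c d)
    (h29 : 29 ∣ b) (h409 : 409 ∣ a ^ 2 - U * b ^ 2) (hb : ¬ 409 ∣ b)
    (hU : jacobiSym (U ^ 2 + 8) 409 = -1) :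
    jacobiSym (-11861) (a ^ 4 + 8 * b ^ 4).natAbs = -1 := by
  rw [h.next.jac]
  have h1 : jacobiSym (a ^ 4 + 8 * b ^ 4) 29 = 1 := by
    obtain ⟨e, rfl⟩ := h29
    have ha : Int.gcd (a ^ 2) (29 : ℕ) = 1 := by
      rw [← Int.isCoprime_iff_gcd_eq_one]
      exact (IsCoprime.of_mul_right_left h.cop).pow_left
    rw [← jacobiSym.sq_one' ha]
    apply jacobiSym.mod_left'
    push_cast
    apply Int.ModEq.eq
    apply Int.ModEq.symm
    rw [Int.modEq_iff_dvd]
    exact ⟨8 * 29 ^ 3 * e ^ 4, by ring⟩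
  have h2 : jacobiSym (a ^ 4 + 8 * b ^ 4) 409 = -1 := by
    have hg : Int.gcd (b ^ 2) (409 : ℕ) = 1 := by
      rw [← Int.isCoprime_iff_gcd_eq_one]
      exact ((prime409.coprime_iff_not_dvd.2 hb).symm).pow_left
    obtain ⟨q, hq⟩ := h409
    have e3 : a ^ 2 = U * b ^ 2 + 409 * q := by linear_combination hq
    have : jacobiSym (a ^ 4 + 8 * b ^ 4) 409 = jacobiSym ((U ^ 2 + 8) * (b ^ 2) ^ 2) 409 := by
      apply jacobiSym.mod_left'
      apply Int.ModEq.eq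
      apply Int.ModEq.symm
      rw [Int.modEq_iff_dvd]
      have e4 : a ^ 4 = (U * b ^ 2 + 409 * q) ^ 2 := by rw [← e3]; ring
      rw [e4]
      exact ⟨2 * U * b ^ 2 * q + 409 * q ^ 2, by push_cast; ring⟩
    rw [this, jacobiSym.mul_left, jacobiSym.sq_one' hg, hU, mul_one]
  rw [h1, h2]; norm_num

theorem base1 : ∃ a b c d, St (2 ^ 4 • S0) a b c d ∧ 29 ∣ b ∧
    409 ∣ a ^ 2 - tab 2 * b ^ 2 ∧ ¬ 409 ∣ b := by
  refine ⟨_, _, _, _, st_1_2.next.next, ?_, ?_, ?_⟩ <;> decide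

theorem base3 : ∃ a b c d, St (2 ^ 4 • (3 • S0)) a b c d ∧ 29 ∣ b ∧
    409 ∣ a ^ 2 - tab 9 * b ^ 2 ∧ ¬ 409 ∣ b := by
  refine ⟨_, _, _, _, st_3_2.next.next, ?_, ?_, ?_⟩ <;> decide

open scoped Fin.CommRing Fin.NatCast in
/-- For every `k ≥ 2` one of the two towers carries the obstruction. -/
theorem obstruction {k : ℕ} (hk : 2 ≤ k) :
    ∃ a b c d, (St (2 ^ k • S0) a b c d ∨ St (2 ^ k • (3 • S0)) a b c d) ∧
      jacobiSym (-11861) a.natAbs = -1 := by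
  obtain rfl | rfl | rfl | hk5 : k = 2 ∨ k = 3 ∨ k = 4 ∨ 5 ≤ k := by omega
  · refine ⟨_, _, _, _, Or.inr st_3_2, ?_⟩
    rw [st_3_2.jac]; norm_num
  · refine ⟨_, _, _, _, Or.inr st_3_2.next, ?_⟩
    rw [st_3_2.next.jac]; norm_num
  · refine ⟨_, _, _, _, Or.inl st_1_2.next.next, ?_⟩
    rw [st_1_2.next.next.jac]; norm_num
  · obtain ⟨i, rfl⟩ : ∃ i, k = 4 + i + 1 := ⟨k - 5, by omega⟩
    rcases tab_choice i with h | h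
    · obtain ⟨a, b, c, d, h1, h2, h3, h4⟩ := tower base1 i
      exact ⟨_, _, _, _, Or.inl h1.next, tower_jac h1 h2 h3 h4 h⟩
    · obtain ⟨a, b, c, d, h1, h2, h3, h4⟩ := tower base3 i
      exact ⟨_, _, _, _, Or.inr h1.next, tower_jac h1 h2 h3 h4 h⟩

theorem aux7 : ∀ X s : ZMod 7, X = 4 → 3 * X - 4 = 8 * 409 * s ^ 2 → False := by decide

theorem aux7a : (3272 : ZMod 7) ≠ 0 := by decide

theorem aux7b : ((40664 : ℤ) : ZMod 7) ≠ 0 := by decide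

theorem aux7c : ((1156 ^ 2 : ℤ) : ZMod 7) ≠ 0 := by decide

theorem aux7d : ((-7 * 1156 : ℤ) : ZMod 7) = 0 := by decide

theorem aux7e : ((-40664 * 7 : ℤ) : ZMod 7) = 0 := by decide

theorem mod_three_aux {R : EC.Point} {P : EC.Point} {y0 : ℚ} {Y : ZMod 7} (hP : IsPt P 4 y0)
    (hY : Rd 7 y0 Y) {m : ℤ}
    (hR : R = P + m • (3 • S0)) {v w y : ℚ} (hv : IsPt R (4 * v ^ 2) y)
    (hw : 3 * v ^ 2 - 1 = 818 * w ^ 2) : False := by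
  have : Fact (Nat.Prime 7) := ⟨by norm_num⟩
  have r4 : Rd 7 4 4 := (Rd.int 7 4).congr (by norm_num) (by norm_num)
  have r3 : Rd 7 3 3 := (Rd.int 7 3).congr (by norm_num) (by norm_num)
  have r3272 : Rd 7 3272 3272 := (Rd.int 7 3272).congr (by norm_num) (by norm_num)
  have z : (3272 : ZMod 7) ≠ 0 := aux7a
  obtain ⟨x', y', hx', hrx, -⟩ := reduction_int hP isPt_3S0 r4 hY (by norm_num) (by norm_num)
    ⟨-7 * 1156, 40664, aux7b, by norm_num, by rw [zero_mul]; exact aux7d⟩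
    ⟨-40664 * 7, 1156 ^ 2, aux7c, by norm_num, by rw [zero_mul]; exact aux7e⟩ m
  rw [← hR] at hx'
  have e := (hx'.unique hv).1
  have r5 : Rd 7 (w ^ 2) ((3 * 4 - 4) / 3272) :=
    (((r3.mul hrx).sub r4).div r3272 z).congr (by rw [e]; linear_combination hw / 818) rfl
  obtain ⟨s, hs⟩ := r5.sqrt
  rw [div_eq_iff z] at hs
  exact aux7 4 s rfl (by rw [hs]; norm_num; ring)

theorem three_dvd_N {N : ℤ} {v w y : ℚ} (hv : IsPt (N • S0) (4 * v ^ 2) y)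
    (hw : 3 * v ^ 2 - 1 = 818 * w ^ 2) : 3 ∣ N := by
  have : Fact (Nat.Prime 7) := ⟨by norm_num⟩
  by_contra h
  have h1 : N = 1 + (N / 3) * 3 ∨ N = -1 + (N / 3 + 1) * 3 := by omega
  have r8 := Rd.int 7 8
  rcases h1 with h1 | h1
  · refine mod_three_aux (m := N / 3) isPt_S0 (r8.congr (by norm_num) rfl) ?_ hv hw
    conv_lhs => rw [h1, add_zsmul, one_zsmul, mul_zsmul]
    rfl
  · refine mod_three_aux (m := N / 3 + 1) isPt_S0.neg (r8.neg.congr (by norm_num) rfl) ?_ hv hw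
    conv_lhs => rw [h1, add_zsmul, neg_zsmul, one_zsmul, mul_zsmul]
    rfl

theorem eq_three_aux {N : ℤ} (hN : N % 4 = 3) {v w y : ℚ} (hv : IsPt (N • S0) (4 * v ^ 2) y)
    (hv0 : v ≠ 0) (hw : 3 * v ^ 2 - 1 = 818 * w ^ 2) : N = 3 := by
  by_contra hne
  have h3 := three_dvd_N hv hw
  have h0 : (N - 3).natAbs ≠ 0 := by omega
  obtain ⟨k, m, hm, hkm⟩ := Nat.exists_eq_two_pow_mul_odd h0
  obtain ⟨m', hm', hkm'⟩ : ∃ m' : ℤ, Odd m' ∧ N - 3 = 2 ^ k * m' := by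
    rcases Int.natAbs_eq (N - 3) with h | h
    · exact ⟨m, by exact_mod_cast hm, by rw [h, hkm]; push_cast; ring⟩
    · exact ⟨-m, Odd.neg (by exact_mod_cast hm), by rw [h, hkm]; push_cast; ring⟩
  have hk : 2 ≤ k := by
    by_contra hk
    obtain ⟨t, ht⟩ := hm'
    have : k = 0 ∨ k = 1 := by omega
    rcases this with rfl | rfl <;> norm_num at hkm' <;> omega
  have h3m : 3 ∣ m' := by
    have : (3 : ℤ) ∣ 2 ^ k * m' := by rw [← hkm']; omega
    rcases Int.prime_three.dvd_or_dvd this with h | h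
    · have := Int.prime_three.dvd_of_dvd_pow h
      omega
    · exact h
  obtain ⟨n, rfl⟩ := h3m
  have hn : Odd n := (Int.odd_mul.1 hm').2
  have e : N = 3 + 2 ^ k * (3 * n) := by linarith
  obtain ⟨a, b, c, d, hst, hJ⟩ := obstruction hk
  rcases hst with hst | hst
  · refine sieve hst hJ hm' ?_ hv hv0 hw
    conv_lhs => rw [e, add_zsmul]
    congr 1
    rw [← natCast_zsmul, ← mul_zsmul]
    congr 1
    push_cast
    ring
  · refine sieve hst hJ hn ?_ hv hv0 hw
    conv_lhs => rw [e, add_zsmul]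
    congr 1
    rw [← natCast_zsmul, ← natCast_zsmul, ← mul_zsmul, ← mul_zsmul]
    congr 1
    push_cast
    ring

theorem eq_three {N : ℤ} (hN : Odd N) {v w y : ℚ} (hv : IsPt (N • S0) (4 * v ^ 2) y)
    (hv0 : v ≠ 0) (hw : 3 * v ^ 2 - 1 = 818 * w ^ 2) : N = 3 ∨ N = -3 := by
  have h : N % 4 = 3 ∨ (-N) % 4 = 3 := by
    obtain ⟨t, rfl⟩ := hN; omega
  rcases h with h | h
  · exact Or.inl (eq_three_aux h hv hv0 hw)
  · right
    have hv' := hv.neg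
    rw [← neg_zsmul] at hv'
    have := eq_three_aux h hv' hv0 hw
    omega

theorem v_sq_eq {N : ℤ} (hN : Odd N) {v w y : ℚ} (hv : IsPt (N • S0) (4 * v ^ 2) y)
    (hv0 : v ≠ 0) (hw : 3 * v ^ 2 - 1 = 818 * w ^ 2) : v ^ 2 = 289 / 49 := by
  rcases eq_three hN hv hv0 hw with rfl | rfl
  · have := (hv.unique isPt_3S0).1
    linarith
  · have h1 : (-3 : ℤ) • S0 = -(3 • S0) := by rw [neg_zsmul]; rfl
    rw [h1] at hv
    have := (hv.unique isPt_3S0.neg).1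
    linarith


theorem descent_id {a b c d : ℤ} (h1 : a ^ 2 + c ^ 2 = 2 * b ^ 2) (h2 : a ^ 2 + d ^ 2 = 2 * c ^ 2) :
    ((a + 2 * c + d) ^ 2 + 2 * (a + 2 * b - c) ^ 2) ^ 2 * (b ^ 2 - a ^ 2) ^ 2 =
      2 * ((a + 2 * b - c) * (3 * a + 4 * b + d) * (a + 2 * c + d) * (d + 3 * c - 2 * b)) *
        (a * c - b * d) ^ 2 := by
  have hc : c ^ 2 - (2 * b ^ 2 - a ^ 2) = 0 := by linarith
  have hd : d ^ 2 - (4 * b ^ 2 - 3 * a ^ 2) = 0 := by linarith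
  linear_combination ((-12)*a^2*b^4 + (8)*a^4*b^2 + (-12)*a^6 + (-72)*a*b^4*d + (48)*a^3*b^2*d + (36)*b^4*c^2 +
      (-160)*a^2*b^2*c^2 + (-12)*a^4*c^2 + (96)*b^4*c*d + (60)*a^2*b^2*c*d + (-24)*a^3*b^3 +
      (-8)*b^6 + (96)*b^5*c + (-48)*a^2*b^3*c + (-32)*b^5*d + (-24)*a^2*b^3*d + (32)*a^4*b*d +
      (-48)*a^5*c + (-16)*a^3*b*c*d + (20)*a^3*b^2*c + (-48)*a^3*b*c^2 + (24)*a^3*c^2*d +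
      (176)*a*b^3*c*d + (-64)*a^2*b*c^2*d + (36)*a^3*c^3 + (48)*a^2*b*c^3 + (-96)*a*b^2*c^2*d +
      (12)*a^2*c^3*d + (80)*a*b^4*c + (-96)*a*b^3*c^2) * hc +
      ((-1)*a^2*b^4 + (30)*a^4*b^2 + (7)*a^6 + (-8)*a*b^4*c + (-60)*a^3*b^2*c + (16)*a^5*c +
      (28)*a*b^4*d + (-8)*a^3*b^2*d + (4)*a^5*d + (-60)*b^4*c^2 + (112)*a^2*b^2*c^2 +
      (20)*a^4*c^2 + (-64)*b^4*c*d + (-12)*a^2*b^2*c*d + (8)*a^4*c*d + (-7)*b^4*d^2 +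
      (-10)*a^2*b^2*d^2 + (1)*a^4*d^2 + (-32)*a*b^5 + (40)*a^3*b^3 + (16)*a^5*b + (-12)*b^6 +
      (-16)*b^5*c + (-16)*a^2*b^3*c + (-16)*a^4*b*c + (52)*a^3*b*c^2 + (8)*a^2*b^3*d +
      (16)*a^3*b*c*d + (24)*a*b^3*c^2 + (-96)*a*b^3*c*d + (-20)*a*b^3*d^2 + (-64)*a^2*b*c^3 +
      (56)*a*b^2*c^2*d + (-2)*a^3*c^3 + (6)*a*b^2*c*d^2 + (-2)*a^3*c^2*d + (4)*a^2*b*c*d^2 +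
      (-2)*a*b^2*d^3 + (16)*b^5*d + (20)*a*b^2*c^3 + (8)*b^3*c^2*d + (-16)*b^3*c*d^2 +
      (-4)*b^3*d^3 + (48)*b^3*c^3 + (-24)*a*b*c^4 + (12)*b^2*c^3*d + (10)*a^2*c^4 +
      (-20)*a*b*c^3*d + (10)*b^2*c^2*d^2 + (2)*a^2*c^3*d + (-4)*a*b*c^2*d^2 + (2)*b^2*c*d^3) * hd

theorem odd_prime_aux {p n x : ℤ} (hp : Prime p) (hn : p ∣ n) (ho : Odd n) (h : p ∣ 2 * x) :
    p ∣ x := by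
  rcases hp.dvd_or_dvd h with h | h
  · exfalso
    obtain ⟨k, rfl⟩ := ho
    have h1 : p ∣ 2 * k := h.mul_right k
    exact hp.not_dvd_one ((dvd_add_right h1).1 hn)
  · exact h

theorem six_sq_aux (n : ℕ) : ∀ A B s : ℤ, s.natAbs = n → A ^ 2 + B ^ 2 = 6 * s ^ 2 → s = 0 := by
  induction n using Nat.strong_induction_on with
  | _ n ih =>
    intro A B s hs h
    obtain ⟨⟨A', rfl⟩, ⟨B', rfl⟩⟩ := three_dvd_of (a := A) (b := B) ⟨2 * s ^ 2, by linarith⟩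
    have h3 : (3 : ℤ) ∣ s ^ 2 := by
      have : 3 * (A' ^ 2 + B' ^ 2) = 2 * s ^ 2 := by linarith
      omega
    obtain ⟨t, rfl⟩ := Int.prime_three.dvd_of_dvd_pow h3
    by_contra h0
    have := ih t.natAbs (by omega) A' B' t rfl (by linarith)
    omega

theorem sq_mod_four (x : ℤ) : x ^ 2 % 4 = 0 ∨ x ^ 2 % 4 = 1 := by
  rcases Int.even_or_odd' x with ⟨k, rfl | rfl⟩ <;> ring_nf <;> omega

/-- A factor `≡ 1 mod 4` in a coprime factorisation of minus a square is a square. -/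
theorem sq_of_neg_mul {x y z : ℤ} (h : IsCoprime x y) (hx : x % 4 = 1) (e : x * y = -z ^ 2) :
    ∃ s, x = s ^ 2 := by
  obtain ⟨s, hs | hs⟩ := Int.sq_of_isCoprime (c := z) h.neg_right (by linarith)
  · exact ⟨s, hs⟩
  · have := sq_mod_four s
    omega

/-- The arithmetic part of the descent step. -/
theorem descent_arith {a b c d n0 n1 n2 n4 : ℤ} (h1 : a ^ 2 + c ^ 2 = 2 * b ^ 2)
    (h2 : a ^ 2 + d ^ 2 = 2 * c ^ 2) (hac : IsCoprime a c) (hne : b ^ 2 - a ^ 2 ≠ 0)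
    (e0 : 2 * n0 = a + 2 * b - c) (e1 : 8 * n1 = 3 * a + 4 * b + d)
    (e2 : 4 * n2 = a + 2 * c + d) (e4 : 2 * n4 = d + 3 * c - 2 * b)
    (m0 : n0 % 4 = 1) (m2 : n2 % 4 = 1) (hκ : 8 ∣ a - d) (hac2 : 2 ∣ a + c) :
    ∃ A B C D, n0 = A ^ 2 ∧ n1 = C ^ 2 ∧ n2 = B ^ 2 ∧ n4 = D ^ 2 := by
  have hp0 : ∀ p : ℤ, Prime p → p ∣ a → ¬ p ∣ c := fun p hp h h' =>
    hp.not_isUnit (hac.isUnit_of_dvd' h h')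
  have o0 : Odd n0 := by rw [Int.odd_iff]; omega
  have o2 : Odd n2 := by rw [Int.odd_iff]; omega
  have o1 : Odd n1 := by rw [Int.odd_iff]; omega
  obtain ⟨κ, hκ⟩ := hκ
  obtain ⟨f, hf⟩ := hac2
  have k0 : n0 * (n0 - 2 * b) = -f ^ 2 := by
    have : 4 * (n0 * (n0 - 2 * b)) = 4 * -f ^ 2 := by
      linear_combination (2 * n0 - 4 * b + a + 2 * b - c) * e0 - (2 * f + a + c) * hf + 2 * h1
    linarith
  have k2 : n2 * (n2 - c) = -(2 * κ) ^ 2 := by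
    have : 16 * (n2 * (n2 - c)) = 16 * -(2 * κ) ^ 2 := by
      linear_combination (4 * n2 - 4 * c + a + 2 * c + d) * e2 - (8 * κ + a - d) * hκ + 2 * h2
    linarith
  have k1 : n1 * (n1 - b) = -3 * κ ^ 2 := by
    have : 64 * (n1 * (n1 - b)) = 64 * (-3 * κ ^ 2) := by
      linear_combination (8 * n1 - 8 * b + 3 * a + 4 * b + d) * e1 - 3 * (8 * κ + a - d) * hκ
        + 8 * h1 + 4 * h2
    linarith
  have c0 : IsCoprime n0 (n0 - 2 * b) := by
    refine isCoprime_of_prime_dvd (by omega) fun p hp hd hd' => ?_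
    have hb : p ∣ b := odd_prime_aux hp hd o0 (by
      have := dvd_sub hd hd'
      rwa [sub_sub_cancel] at this)
    have hpf : p ∣ f := hp.dvd_of_dvd_pow (n := 2) (by
      rw [← dvd_neg, ← k0]; exact hd.mul_right _)
    have ha : p ∣ a := odd_prime_aux hp hd o0 (by
      have : 2 * a = 2 * n0 - 2 * b + 2 * f := by linarith
      rw [this]
      exact dvd_add (dvd_sub (hd.mul_left 2) (hb.mul_left 2)) (hpf.mul_left 2))
    refine hp0 p hp ha ?_
    have : c = 2 * f - a := by linarith
    rw [this]
    exact dvd_sub (hpf.mul_left 2) ha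
  have c2 : IsCoprime n2 (n2 - c) := by
    refine isCoprime_of_prime_dvd (by omega) fun p hp hd hd' => ?_
    have hc : p ∣ c := by
      have := dvd_sub hd hd'
      rwa [sub_sub_cancel] at this
    have hpf : p ∣ 2 * κ := hp.dvd_of_dvd_pow (n := 2) (by
      rw [← dvd_neg, ← k2]; exact hd.mul_right _)
    refine hp0 p hp (odd_prime_aux hp hd o2 ?_) hc
    have : 2 * a = 4 * n2 - 2 * c + 4 * (2 * κ) := by linarith
    rw [this]
    exact dvd_add (dvd_sub (hd.mul_left 4) (hc.mul_left 2)) (hpf.mul_left 4)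
  have c1 : IsCoprime n1 (n1 - b) := by
    refine isCoprime_of_prime_dvd (by omega) fun p hp hd hd' => ?_
    have hb : p ∣ b := by
      have := dvd_sub hd hd'
      rwa [sub_sub_cancel] at this
    have hb2 : p ∣ a ^ 2 + c ^ 2 := by
      rw [h1, sq]; exact (hb.mul_left b).mul_left 2
    have h3κ : p ∣ 3 * κ ^ 2 := by
      rw [← dvd_neg, ← neg_mul, ← k1]; exact hd.mul_right _
    rcases hp.dvd_or_dvd h3κ with h3 | h3
    · have h3' : (3 : ℤ) ∣ p := (hp.associated_of_dvd Int.prime_three h3).symm.dvd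
      obtain ⟨ha, hc⟩ := three_dvd_of (h3'.trans hb2)
      exact hp0 3 Int.prime_three ha hc
    · have hpf := hp.dvd_of_dvd_pow h3
      have ha : p ∣ a := by
        have : a = 2 * n1 - b + 2 * κ := by linarith
        rw [this]
        exact dvd_add (dvd_sub (hd.mul_left 2) hb) (hpf.mul_left 2)
      refine hp0 p hp ha (hp.dvd_of_dvd_pow (n := 2) ?_)
      rw [sq a] at hb2
      exact (dvd_add_right (ha.mul_left a)).1 hb2
  obtain ⟨A, hA⟩ := sq_of_neg_mul c0 m0 k0
  obtain ⟨B, hB⟩ := sq_of_neg_mul c2 m2 k2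
  have hA0 : A ≠ 0 := by rintro rfl; norm_num at hA; omega
  have hB0 : B ≠ 0 := by rintro rfl; norm_num at hB; omega
  have hsum : A ^ 2 + B ^ 2 = 2 * n1 := by linarith
  have hpos : 0 < n1 := by
    have : 0 < A ^ 2 := by positivity
    have : 0 < B ^ 2 := by positivity
    omega
  obtain ⟨C, hC⟩ : ∃ C, n1 = C ^ 2 := by
    have h3 : (3 : ℤ) ∣ n1 * (n1 - b) := ⟨-κ ^ 2, by rw [k1]; ring⟩
    rcases Int.prime_three.dvd_or_dvd h3 with ⟨t, ht⟩ | ⟨t, ht⟩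
    · exfalso
      have ct : IsCoprime t (n1 - b) := c1.of_isCoprime_of_dvd_left ⟨3, by linarith⟩
      obtain ⟨s, hs⟩ := Int.sq_of_isCoprime (c := κ) ct.neg_right (by
        rw [ht] at k1 ⊢
        linarith)
      have hs2 := sq_nonneg s
      have hs' : t = s ^ 2 := by
        rcases hs with hs | hs <;> omega
      have := six_sq_aux _ A B s rfl (by rw [hsum, ht, hs']; ring)
      subst this
      norm_num at hs'
      omega
    · have ct : IsCoprime n1 t := c1.of_isCoprime_of_dvd_right ⟨3, by linarith⟩
      obtain ⟨s, hs⟩ := Int.sq_of_isCoprime (c := κ) ct.neg_right (by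
        rw [ht] at k1
        linarith)
      have hs2 := sq_nonneg s
      exact ⟨s, by rcases hs with hs | hs <;> omega⟩
  have key : (2 * n2 ^ 2 + n0 ^ 2) ^ 2 * (b ^ 2 - a ^ 2) ^ 2 =
      4 * (n0 * n1 * n2 * n4) * (a * c - b * d) ^ 2 := by
    have := descent_id h1 h2
    rw [← e0, ← e1, ← e2, ← e4] at this
    linarith
  have hY : (2 * n2 ^ 2 + n0 ^ 2) * (b ^ 2 - a ^ 2) ≠ 0 := by
    refine mul_ne_zero ?_ hne
    have : n0 ≠ 0 := by omega
    positivity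
  have key2 : ((2 * n2 ^ 2 + n0 ^ 2) * (b ^ 2 - a ^ 2)) ^ 2 =
      (2 * A * B * C * (a * c - b * d)) ^ 2 * n4 := by
    rw [mul_pow, key, hA, hB, hC]; ring
  obtain ⟨D, hD⟩ := (Int.pow_dvd_pow_iff two_ne_zero).1 ⟨n4, key2⟩
  refine ⟨A, B, C, D, hA, hC, hB, ?_⟩
  have hZ : (2 * A * B * C * (a * c - b * d)) ^ 2 ≠ 0 := by
    intro h0
    rw [h0, zero_mul] at key2
    exact hY (pow_eq_zero_iff two_ne_zero |>.1 key2)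
  apply mul_left_cancel₀ hZ
  rw [← key2, hD, mul_pow]


theorem exists_sign {z : ℤ} (hz : Odd z) : ∃ k : ℤ, z ^ 2 = (1 + 4 * k) ^ 2 := by
  obtain ⟨t, rfl⟩ := hz
  rcases Int.even_or_odd' t with ⟨s, rfl | rfl⟩
  · exact ⟨s, by ring⟩
  · exact ⟨-s - 1, by ring⟩

/-- The point of the elliptic curve attached to a quadruple. -/
theorem exists_quad_pt {a b c d : ℤ} (h1 : a ^ 2 + c ^ 2 = 2 * b ^ 2)
    (h2 : a ^ 2 + d ^ 2 = 2 * c ^ 2) (ha : a ≠ 0) :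
    ∃ P, IsPt P (4 * c ^ 2 / a ^ 2 : ℚ) (8 * b * c * d / a ^ 3 : ℚ) := by
  apply exists_isPt
  have ha' : (a : ℚ) ≠ 0 := by exact_mod_cast ha
  have hb : (b : ℚ) ^ 2 = (a ^ 2 + c ^ 2) / 2 := by
    have : (a : ℚ) ^ 2 + c ^ 2 = 2 * b ^ 2 := by exact_mod_cast h1
    linarith
  have hd : (d : ℚ) ^ 2 = 2 * c ^ 2 - a ^ 2 := by
    have : (a : ℚ) ^ 2 + d ^ 2 = 2 * c ^ 2 := by exact_mod_cast h2
    linarith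
  rw [div_pow, mul_pow, mul_pow, mul_pow, hb, hd]
  field_simp
  ring

theorem odd_of_sq {x : ℤ} (h : x ^ 2 % 2 = 1) : Odd x := by
  rw [← Int.odd_iff] at h
  exact (Int.odd_pow' two_ne_zero).1 h

/-- The group-theoretic part of the descent step. -/
theorem descent_group {a b c d A B C D : ℤ} {P R : EC.Point}
    (h1 : a ^ 2 + c ^ 2 = 2 * b ^ 2) (h2 : a ^ 2 + d ^ 2 = 2 * c ^ 2) (ha : a ≠ 0)
    (hne : b ^ 2 - a ^ 2 ≠ 0)
    (hA : 2 * A ^ 2 = a + 2 * b - c) (hC : 8 * C ^ 2 = 3 * a + 4 * b + d)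
    (hB : 4 * B ^ 2 = a + 2 * c + d) (hD : 2 * D ^ 2 = d + 3 * c - 2 * b)
    (A0 : A ≠ 0) (B0 : B ≠ 0) (C0 : C ≠ 0) (D0 : D ≠ 0)
    (hP : IsPt P (4 * c ^ 2 / a ^ 2) (8 * b * c * d / a ^ 3))
    (hR : IsPt R (4 * B ^ 2 / A ^ 2) (8 * C * B * D / A ^ 3)) :
    P + S0 = R + R ∨ P + S0 = -(R + R) := by
  have key := descent_id h1 h2
  rw [← hA, ← hC, ← hB, ← hD] at key
  have key' : (2 * (B : ℚ) ^ 4 + A ^ 4) ^ 2 * (b ^ 2 - a ^ 2) ^ 2 =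
      4 * (A * B * C * D) ^ 2 * (a * c - b * d) ^ 2 := by
    have : (2 * B ^ 4 + A ^ 4) ^ 2 * (b ^ 2 - a ^ 2) ^ 2 =
      4 * (A * B * C * D) ^ 2 * (a * c - b * d) ^ 2 := by linarith
    exact_mod_cast this
  have ha' : (a : ℚ) ≠ 0 := by exact_mod_cast ha
  have hA' : (A : ℚ) ≠ 0 := by exact_mod_cast A0
  have hB' : (B : ℚ) ≠ 0 := by exact_mod_cast B0
  have hC' : (C : ℚ) ≠ 0 := by exact_mod_cast C0
  have hD' : (D : ℚ) ≠ 0 := by exact_mod_cast D0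
  have hr' : (b : ℚ) ^ 2 - a ^ 2 ≠ 0 := by exact_mod_cast hne
  have g1 : (a : ℚ) ^ 2 + c ^ 2 = 2 * b ^ 2 := by exact_mod_cast h1
  have g2 : (a : ℚ) ^ 2 + d ^ 2 = 2 * c ^ 2 := by exact_mod_cast h2
  have hx : (4 * c ^ 2 / a ^ 2 : ℚ) ≠ 4 := by
    rw [Ne, div_eq_iff (by positivity)]
    intro h
    apply hr'
    linarith
  have d1 := hR.dbl' (by positivity)
  have d2 := hP.add isPt_S0 hx
    (L := (b * c * d - a ^ 3) / (a * (b ^ 2 - a ^ 2))) (by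
      have : (c : ℚ) ^ 2 = 2 * b ^ 2 - a ^ 2 := by linarith
      rw [this]
      field_simp
      ring)
  have e : ((b * c * d - a ^ 3) / (a * (b ^ 2 - a ^ 2)) : ℚ) ^ 2 - 2 - 4 * c ^ 2 / a ^ 2 - 4 =
      (((4 * B ^ 2 / A ^ 2) ^ 2 + 8) / (2 * (8 * C * B * D / A ^ 3))) ^ 2 := by
    have e1 : (((4 * B ^ 2 / A ^ 2) ^ 2 + 8) / (2 * (8 * C * B * D / A ^ 3)) : ℚ) ^ 2 =
        (a * c - b * d) ^ 2 / (b ^ 2 - a ^ 2) ^ 2 := by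
      rw [eq_div_iff (by positivity)]
      have : (((4 * B ^ 2 / A ^ 2) ^ 2 + 8) / (2 * (8 * C * B * D / A ^ 3)) : ℚ) =
        (2 * (B : ℚ) ^ 4 + A ^ 4) / (2 * (A * B * C * D)) := by
        field_simp
        ring
      rw [this, div_pow, div_mul_eq_mul_div, key', div_eq_iff (by positivity)]
      ring
    rw [e1]
    have hc : (c : ℚ) ^ 2 - (2 * b ^ 2 - a ^ 2) = 0 := by linarith
    have hd : (d : ℚ) ^ 2 - (4 * b ^ 2 - 3 * a ^ 2) = 0 := by linarith
    field_simp
    linear_combination ((b : ℚ) ^ 2 * (c ^ 2 - a ^ 2)) * hd + (5 * (a : ℚ) ^ 2 * (b ^ 2 - a ^ 2)) * hc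
  exact d2.eq_or_neg (d1.congr e.symm rfl)


theorem quad_odd {a b c d : ℤ} (h1 : a ^ 2 + c ^ 2 = 2 * b ^ 2) (h2 : a ^ 2 + d ^ 2 = 2 * c ^ 2)
    (hac : IsCoprime a c) : Odd a ∧ Odd b ∧ Odd c ∧ Odd d := by
  have sa := sq_mod_four a
  have sb := sq_mod_four b
  have sc := sq_mod_four c
  have sd := sq_mod_four d
  have hn : ¬ (2 ∣ a ∧ 2 ∣ c) := fun h => Int.prime_two.not_isUnit (hac.isUnit_of_dvd' h.1 h.2)
  have hn' : ¬ (a ^ 2 % 4 = 0 ∧ c ^ 2 % 4 = 0) := fun h => hn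
    ⟨Int.prime_two.dvd_of_dvd_pow (n := 2) (by omega),
      Int.prime_two.dvd_of_dvd_pow (n := 2) (by omega)⟩
  refine ⟨odd_of_sq ?_, odd_of_sq ?_, odd_of_sq ?_, odd_of_sq ?_⟩ <;> omega

theorem small_aux {g X X' M : ℤ} (hg : g ≠ 0) (hM : 2 ≤ M) (hX : X = g * X')
    (hle : X ^ 2 ≤ 2 * (M + 1)) : X' ^ 2 ≤ M ^ 2 := by
  have hg2 : 0 < g ^ 2 := by positivity
  have h3 : X' ^ 2 ≤ X ^ 2 := by
    rw [hX, mul_pow]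
    nlinarith [sq_nonneg X']
  by_contra hlt
  push Not at hlt
  have h4 : M < |X'| := by
    have := sq_lt_sq.1 hlt
    rwa [abs_of_nonneg (by omega)] at this
  have h5 : (M + 1) ^ 2 ≤ X' ^ 2 := by
    rw [← sq_abs X']
    have : M + 1 ≤ |X'| := h4
    gcongr
  nlinarith

set_option maxHeartbeats 1000000 in
theorem descent (M : ℕ) : ∀ (a b c d : ℤ) (P : EC.Point) (y : ℚ),
    a ^ 2 + c ^ 2 = 2 * b ^ 2 → a ^ 2 + d ^ 2 = 2 * c ^ 2 → IsCoprime a c → a ≠ 0 →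
    a ^ 2 ≤ (M : ℤ) ^ 2 → c ^ 2 ≤ (M : ℤ) ^ 2 →
    IsPt P (4 * c ^ 2 / a ^ 2) y → ∃ N : ℤ, Odd N ∧ P = N • S0 := by
  induction M with
  | zero =>
    intro a b c d P y _ _ _ ha hle
    exfalso
    have : 0 < a ^ 2 := by positivity
    norm_num at hle
    omega
  | succ M ih =>
    intro a b c d P y h1 h2 hac ha hle hle' hP
    by_cases hne : b ^ 2 - a ^ 2 = 0
    · have e : (4 * c ^ 2 / a ^ 2 : ℚ) = 4 := by
        have h : (c : ℚ) ^ 2 = a ^ 2 := by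
          have : c ^ 2 = a ^ 2 := by linarith
          exact_mod_cast this
        have : (a : ℚ) ≠ 0 := by exact_mod_cast ha
        rw [h]; field_simp
      rcases (hP.congr e rfl).eq_or_neg isPt_S0 with h | h
      · exact ⟨1, odd_one, by rw [h, one_zsmul]⟩
      · exact ⟨-1, by decide, by rw [h, neg_zsmul, one_zsmul]⟩
    obtain ⟨oa, ob, oc, od⟩ := quad_odd h1 h2 hac
    obtain ⟨α, hα⟩ := exists_sign oa
    obtain ⟨β, hβ⟩ := exists_sign ob
    obtain ⟨γ, hγ⟩ := exists_sign oc
    obtain ⟨δ, hδ⟩ := exists_sign od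
    have haa : (a : ℚ) ^ 2 = ((1 + 4 * α : ℤ) : ℚ) ^ 2 := by exact_mod_cast hα
    have hcc : (c : ℚ) ^ 2 = ((1 + 4 * γ : ℤ) : ℚ) ^ 2 := by exact_mod_cast hγ
    have hac' : IsCoprime (1 + 4 * α) (1 + 4 * γ) := by
      rw [← IsCoprime.pow_iff two_pos two_pos, ← hα, ← hγ]
      exact hac.pow
    rw [haa, hcc] at hP
    rw [hα, hγ, hβ] at h1
    rw [hα, hγ, hδ] at h2
    rw [hα] at hle
    rw [hγ] at hle'
    rw [hα, hβ] at hne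
    clear hα hβ hγ hδ haa hcc hac oa ob oc od ha a b c d
    have q1 : (α + γ) + 2 * (α ^ 2 + γ ^ 2) = 2 * β + 4 * β ^ 2 := by linarith
    have q2 : (α + δ) + 2 * (α ^ 2 + δ ^ 2) = 2 * γ + 4 * γ ^ 2 := by linarith
    obtain ⟨f, hf⟩ : 2 ∣ α + γ := by omega
    obtain ⟨e, he⟩ : 2 ∣ α + δ := by omega
    have hδ : δ = 2 * e - α := by linarith
    have hγ : γ = 2 * f - α := by linarith
    have q3 : 2 ∣ e - γ := by
      have : e - γ = 2 * γ ^ 2 - 2 * (α ^ 2 - 2 * e * α + 2 * e ^ 2) := by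
        rw [hδ] at q2; linarith
      omega
    set a := 1 + 4 * α with ha_def
    set b := 1 + 4 * β with hb_def
    set c := 1 + 4 * γ with hc_def
    set d := 1 + 4 * δ with hd_def
    have ha : a ≠ 0 := by omega
    have e0 : 2 * (1 + 2 * (α - γ) + 4 * β) = a + 2 * b - c := by omega
    have e1 : 8 * (1 + α + e + 2 * β) = 3 * a + 4 * b + d := by omega
    have e2 : 4 * (1 + 2 * e + 2 * γ) = a + 2 * c + d := by omega
    have e4 : 2 * (1 + 2 * δ + 6 * γ - 4 * β) = d + 3 * c - 2 * b := by omega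
    obtain ⟨A, B, C, D, hA, hC, hB, hD⟩ := descent_arith h1 h2 hac' hne e0 e1 e2 e4
      (by omega) (by omega) (by omega) (by omega)
    rw [hA] at e0
    rw [hC] at e1
    rw [hB] at e2
    rw [hD] at e4
    have hAo : A ^ 2 % 2 = 1 := by omega
    have hBo : B ^ 2 % 2 = 1 := by omega
    have r1 : A ^ 2 + B ^ 2 = 2 * C ^ 2 := by omega
    have r2 : A ^ 2 + D ^ 2 = 2 * B ^ 2 := by omega
    have A0 : A ≠ 0 := by rintro rfl; norm_num at hAo
    have B0 : B ≠ 0 := by rintro rfl; norm_num at hBo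
    have C0 : C ≠ 0 := by rintro rfl; norm_num at r1; have : 0 < A ^ 2 := by positivity
                          have : 0 < B ^ 2 := by positivity
                          omega
    have D0 : D ≠ 0 := by rintro rfl; norm_num at r2; omega
    obtain ⟨g, A', B', hg, hco, hA', hB'⟩ : ∃ g A' B' : ℤ, g ≠ 0 ∧ IsCoprime A' B' ∧
        A = g * A' ∧ B = g * B' := by
      obtain ⟨A', B', hco, hA', hB'⟩ := Int.exists_gcd_one (m := A) (n := B)
        (Int.gcd_pos_of_ne_zero_left _ A0)
      refine ⟨Int.gcd A B, A', B', ?_, Int.isCoprime_iff_gcd_eq_one.2 hco, ?_, ?_⟩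
      · have := Int.gcd_pos_of_ne_zero_left B A0
        omega
      · rw [mul_comm]; exact hA'
      · rw [mul_comm]; exact hB'
    have hgo : Odd g := by
      have := odd_of_sq hAo
      rw [hA'] at this
      exact (Int.odd_mul.1 this).1
    obtain ⟨D', hD'⟩ : g ∣ D := (Int.pow_dvd_pow_iff two_ne_zero).1
      ⟨2 * B' ^ 2 - A' ^ 2, by rw [hA', hB'] at r2; linarith⟩
    obtain ⟨C', hC'⟩ : g ∣ C := (Int.pow_dvd_pow_iff two_ne_zero).1 (by
      have hc2 : IsCoprime (g ^ 2) 2 := by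
        apply IsCoprime.pow_left
        rw [Int.isCoprime_iff_gcd_eq_one, Int.gcd_comm]
        simpa using (Int.isCoprime_iff_gcd_eq_one.1 (Int.isCoprime_two_left.2 hgo))
      apply hc2.dvd_of_dvd_mul_left
      exact ⟨A' ^ 2 + B' ^ 2, by rw [hA', hB'] at r1; linarith⟩)
    have hg2 : 0 < g ^ 2 := by positivity
    have s1 : A' ^ 2 + B' ^ 2 = 2 * C' ^ 2 := by
      apply mul_left_cancel₀ hg2.ne'
      rw [hA', hB', hC'] at r1
      linarith
    have s2 : A' ^ 2 + D' ^ 2 = 2 * B' ^ 2 := by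
      apply mul_left_cancel₀ hg2.ne'
      rw [hA', hB', hD'] at r2
      linarith
    have A0' : A' ≠ 0 := by rintro rfl; simp at hA'; exact A0 hA'
    have hM : 2 ≤ (M : ℤ) := by
      by_contra hM
      have : (M : ℤ) = 0 ∨ (M : ℤ) = 1 := by omega
      have h4 : ((M + 1 : ℕ) : ℤ) ^ 2 ≤ 4 := by push_cast; rcases this with h | h <;> rw [h] <;> norm_num
      have ha3 : -2 ≤ a ∧ a ≤ 2 := 
        abs_le_of_sq_le_sq' (hle.trans (h4.trans (by norm_num))) (by norm_num)
      have hc3 : -2 ≤ c ∧ c ≤ 2 :=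
        abs_le_of_sq_le_sq' (hle'.trans (h4.trans (by norm_num))) (by norm_num)
      have haa : a = 1 := by omega
      have hcc : c = 1 := by omega
      apply hne
      rw [haa, hcc] at h1
      rw [haa]
      linarith
    push_cast at hle hle'
    have hb2 : b ^ 2 ≤ ((M : ℤ) + 1) ^ 2 := by linarith
    have hd2 : d ^ 2 ≤ (2 * ((M : ℤ) + 1)) ^ 2 := by
      have h3 := sq_nonneg a
      have h4 := sq_nonneg ((M : ℤ) + 1)
      have h5 : (2 * ((M : ℤ) + 1)) ^ 2 = 4 * ((M : ℤ) + 1) ^ 2 := by ring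
      rw [h5]
      omega
    have ba := abs_le_of_sq_le_sq' hle (by omega)
    have bb := abs_le_of_sq_le_sq' hb2 (by omega)
    have bc := abs_le_of_sq_le_sq' hle' (by omega)
    have bd := abs_le_of_sq_le_sq' hd2 (by omega)
    obtain ⟨R, hR⟩ := exists_quad_pt s1 s2 A0'
    obtain ⟨N, hN, hRN⟩ := ih A' C' B' D' R _ s1 s2 hco A0' (small_aux hg hM hA' (by omega))
      (small_aux hg hM hB' (by omega)) hR
    obtain ⟨Q, hQ⟩ := exists_quad_pt h1 h2 ha
    have hR' : IsPt R (4 * B ^ 2 / A ^ 2) (8 * C * B * D / A ^ 3) := by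
      have g0 : (g : ℚ) ≠ 0 := by exact_mod_cast hg
      have a0 : (A' : ℚ) ≠ 0 := by exact_mod_cast A0'
      refine hR.congr ?_ ?_
      · rw [hA', hB']; push_cast; field_simp
      · rw [hA', hB', hC', hD']; push_cast; field_simp
    obtain ⟨N', hN', hQN⟩ : ∃ N : ℤ, Odd N ∧ Q = N • S0 := by
      rcases descent_group h1 h2 ha hne e0 e1 e2 e4 A0 B0 C0 D0 hQ hR' with h | h
      · refine ⟨2 * N - 1, ⟨N - 1, by ring⟩, ?_⟩
        rw [eq_sub_of_add_eq h, hRN, sub_zsmul, one_zsmul, ← add_zsmul]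
        congr 2; ring
      · refine ⟨-2 * N - 1, ⟨-N - 1, by ring⟩, ?_⟩
        rw [eq_sub_of_add_eq h, hRN, sub_zsmul, one_zsmul, ← add_zsmul, ← neg_zsmul]
        congr 2; ring
    rcases hP.eq_or_neg hQ with h | h
    · exact ⟨N', hN', by rw [h, hQN]⟩
    · exact ⟨-N', hN'.neg, by rw [h, hQN, neg_zsmul]⟩


/-- `v ^ 2` is determined by the curve equations. -/
theorem ratio_sq {v p q w : ℚ} (h1 : 1 - 2 * p ^ 2 + v ^ 2 = 0)
    (h2 : p ^ 2 - 2 * v ^ 2 + 409 * w ^ 2 = 0) (h3 : v ^ 2 - 2 * 409 * w ^ 2 + q ^ 2 = 0) :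
    v ^ 2 = 289 / 49 := by
  have hv : v * v.den = v.num := Rat.mul_den_eq_num v
  have hden : (v.den : ℚ) ≠ 0 := by exact_mod_cast v.den_ne_zero
  obtain ⟨b, hb⟩ : ∃ b : ℤ, (v.den : ℤ) ^ 2 + v.num ^ 2 = 2 * b ^ 2 := by
    have hs : IsSquare ((2 * ((v.den : ℤ) ^ 2 + v.num ^ 2) : ℤ) : ℚ) := by
      refine ⟨2 * p * v.den, ?_⟩
      push_cast
      rw [← hv]
      linear_combination 2 * (v.den : ℚ) ^ 2 * h1
    rw [Rat.isSquare_intCast_iff] at hs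
    obtain ⟨r, hr⟩ := hs
    have h2r : (2 : ℤ) ∣ r := Int.prime_two.dvd_of_dvd_pow (n := 2) ⟨_, by rw [sq]; exact hr.symm⟩
    obtain ⟨b, rfl⟩ := h2r
    exact ⟨b, by linarith⟩
  obtain ⟨d, hd⟩ : ∃ d : ℤ, (v.den : ℤ) ^ 2 + d ^ 2 = 2 * v.num ^ 2 := by
    have hs : IsSquare ((2 * v.num ^ 2 - (v.den : ℤ) ^ 2 : ℤ) : ℚ) := by
      refine ⟨q * v.den, ?_⟩
      push_cast
      rw [← hv]
      linear_combination -(v.den : ℚ) ^ 2 * (2 * h2 + h3 + h1)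
    rw [Rat.isSquare_intCast_iff] at hs
    obtain ⟨r, hr⟩ := hs
    exact ⟨r, by linarith⟩
  have hco : IsCoprime (v.den : ℤ) v.num := by
    rw [Int.isCoprime_iff_gcd_eq_one, Int.gcd_comm]
    exact v.reduced
  have ha : (v.den : ℤ) ≠ 0 := by exact_mod_cast v.den_ne_zero
  obtain ⟨P, hP⟩ := exists_quad_pt hb hd ha
  obtain ⟨N, hN, hPN⟩ := descent (v.den + v.num.natAbs) v.den b v.num d P _ hb hd hco ha
    (by
      push_cast
      gcongr
      have := abs_nonneg v.num
      omega)
    (by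
      push_cast
      rw [← sq_abs v.num]
      gcongr
      omega) hP
  subst hPN
  have e : (4 * (v.num : ℚ) ^ 2 / ((v.den : ℤ) : ℚ) ^ 2) = 4 * v ^ 2 := by
    rw [← hv]
    push_cast
    field_simp
  refine v_sq_eq (w := w) hN (hP.congr e rfl) ?_ (by linarith)
  intro hv0
  have : IsSquare (2 : ℚ) := by
    refine ⟨2 * p, ?_⟩
    rw [hv0] at h1
    linarith
  rw [show (2 : ℚ) = ((2 : ℤ) : ℚ) by norm_num, Rat.isSquare_intCast_iff] at this
  exact Int.prime_two.not_isSquare this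

theorem sign_of_sq {x a k : ℚ} (h : x ^ 2 = (a * k) ^ 2) : ∃ ε : ℚ, (ε = 1 ∨ ε = -1) ∧ x = a * k * ε := by
  rcases sq_eq_sq_iff_eq_or_eq_neg.1 h with h | h
  · exact ⟨1, Or.inl rfl, by rw [h, mul_one]⟩
  · exact ⟨-1, Or.inr rfl, by rw [h, mul_neg_one]⟩

theorem two_mul_sq {x y : ℚ} (h : x ^ 2 = 2 * y ^ 2) : x = 0 ∧ y = 0 := by
  have hy : y = 0 := by
    by_contra hy
    have : IsSquare (2 : ℚ) := ⟨x / y, by field_simp; linarith⟩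
    rw [show (2 : ℚ) = ((2 : ℤ) : ℚ) by norm_num, Rat.isSquare_intCast_iff] at this
    exact Int.prime_two.not_isSquare this
  subst hy
  simpa using h

/-- **All rational points of `C₄₀₉`.**
Every nonzero rational solution of the system defining `C₄₀₉` is, up to a nonzero rational
scalar and signs, the tuple `(7, 13, 17, 1, 23)`. Consequently, the only non-constant
arithmetic progression of five squares over `ℚ(√409)`, up to equivalence, is
`7², 13², 17², 409, 23²`. -/
theorem rational_points_C409
    (x : Fin 5 → ℚ) (hx : x ≠ 0)
    (h1 : x 0 ^ 2 - 2 * x 1 ^ 2 + x 2 ^ 2 = 0)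
    (h2 : x 1 ^ 2 - 2 * x 2 ^ 2 + 409 * x 3 ^ 2 = 0)
    (h3 : x 2 ^ 2 - 2 * 409 * x 3 ^ 2 + x 4 ^ 2 = 0) :
    ∃ (lam : ℚ) (ε : Fin 5 → ℚ), lam ≠ 0 ∧ (∀ i, ε i = 1 ∨ ε i = -1) ∧
      x 0 = lam * 7 * ε 0 ∧ x 1 = lam * 13 * ε 1 ∧ x 2 = lam * 17 * ε 2 ∧
      x 3 = lam * ε 3 ∧ x 4 = lam * 23 * ε 4 := by
  have h0 : x 0 ≠ 0 := by
    intro h0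
    rw [h0] at h1
    obtain ⟨e2, e1⟩ := two_mul_sq (x := x 2) (y := x 1) (by linarith)
    rw [e2, e1] at h2
    have e3 : x 3 = 0 := by
      have : x 3 ^ 2 = 0 := by linarith
      simpa using this
    rw [e2, e3] at h3
    have e4 : x 4 = 0 := by
      have : x 4 ^ 2 = 0 := by linarith
      simpa using this
    apply hx
    funext i
    fin_cases i
    · exact h0
    · exact e1
    · exact e2
    · exact e3
    · exact e4
  have hv := ratio_sq (v := x 2 / x 0) (p := x 1 / x 0) (q := x 4 / x 0) (w := x 3 / x 0)
    (by field_simp; linarith) (by field_simp; linarith) (by field_simp; linarith)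
  rw [div_pow, div_eq_iff (by positivity)] at hv
  obtain ⟨ε1, s1, f1⟩ := sign_of_sq (x := x 1) (a := x 0 / 7) (k := 13) (by linarith)
  obtain ⟨ε2, s2, f2⟩ := sign_of_sq (x := x 2) (a := x 0 / 7) (k := 17) (by linarith)
  obtain ⟨ε3, s3, f3⟩ := sign_of_sq (x := x 3) (a := x 0 / 7) (k := 1) (by linarith)
  obtain ⟨ε4, s4, f4⟩ := sign_of_sq (x := x 4) (a := x 0 / 7) (k := 23) (by linarith)
  refine ⟨x 0 / 7, ![1, ε1, ε2, ε3, ε4], by positivity, ?_, ?_, f1, f2, ?_, f4⟩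
  · intro i
    fin_cases i
    · exact Or.inl rfl
    · exact s1
    · exact s2
    · exact s3
    · exact s4
  · show x 0 = x 0 / 7 * 7 * 1
    ring
  · show x 3 = x 0 / 7 * ε3
    rw [f3, mul_one]
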